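/- arXiv:2312.13709 — 3 statements merged into one kernel-verified Lean document; each statement's English description precedes it below -/
import Mathlib

section
/- Let V_1, V_2, V_3 be the vertices of an equilateral triangle inscribed in the unit circle centered at the origin of ℝ² (so |V_i| = 1 and V_1 + V_2 + V_3 = 0). For P ∈ ℝ² let Σ_P := |P − V_1| + |P − V_2| + |P − V_3|, and for ρ ≥ 0 set ℓ(ρ) := inf{ Σ_P : |P| ≥ ρ }. Then ℓ(ρ) ≥ 3 + (3/4)ρ² + o(ρ²) as ρ → 0⁺; that is, liminf_{ρ→0⁺} (ℓ(ρ) − 3)/ρ² ≥ 3/4. -/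
open MeasureTheory Metric Set Filter
open scoped Topology

noncomputable section

/-- Euclidean space `ℝ^d`. -/
abbrev Rd (d : ℕ) : Type := EuclideanSpace ℝ (Fin d)


lemma aux_sqrt (u d : ℝ) (hd : 0 ≤ d) (hd2 : d ^ 2 = 1 + u) (hu : |u| ≤ 1 / 2) :
    1 + u / 2 - u ^ 2 / 8 - |u| ^ 3 ≤ d := by
  refine abs_le_of_sq_le_sq ?_ hd |> fun h => (le_abs_self _).trans h
  rw [hd2]
  rcases abs_cases u with ⟨h, h0⟩ | ⟨h, h0⟩
  · rw [h] at hu ⊢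
    have h3 : 0 ≤ u ^ 3 := by positivity
    have : 0 ≤ u ^ 3 * (1/8 - u/64 + 2 * (1 + u / 2 - u ^ 2 / 8) - u ^ 3) := by
      apply mul_nonneg h3
      nlinarith [mul_nonneg h0 h0, mul_nonneg h0 (sub_nonneg.2 hu), mul_nonneg (mul_nonneg h0 h0) (sub_nonneg.2 hu)]
    nlinarith
  · rw [h] at hu ⊢
    obtain ⟨w, rfl⟩ : ∃ w, u = -w := ⟨-u, by ring⟩
    have h0' : 0 ≤ w := by linarith
    have hu' : w ≤ 1/2 := by linarith
    have h3 : 0 ≤ w ^ 3 := by positivity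
    have : 0 ≤ w ^ 3 * (-1/8 - w/64 + 2 * (1 - w / 2 - w ^ 2 / 8) - w ^ 3) := by
      apply mul_nonneg h3
      nlinarith [mul_nonneg h0' h0', mul_nonneg h0' (sub_nonneg.2 hu'), mul_nonneg (mul_nonneg h0' h0') (sub_nonneg.2 hu')]
    nlinarith

lemma aux_geo (V : Fin 3 → Rd 2)
    (hnorm : ∀ i, ‖V i‖ = 1) (hsum : (∑ i, V i) = 0) (P : Rd 2) :
    ∃ x : Fin 3 → ℝ, (∀ i, dist P (V i) ^ 2 = 1 + (‖P‖ ^ 2 - 2 * x i)) ∧ (∀ i, |x i| ≤ ‖P‖) ∧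
      x 0 + x 1 + x 2 = 0 ∧ x 0 ^ 2 + x 1 ^ 2 + x 2 ^ 2 = 3 / 2 * ‖P‖ ^ 2 := by
  refine ⟨fun i => inner ℝ P (V i), fun i => ?_, fun i => ?_, ?_, ?_⟩
  · rw [dist_eq_norm, norm_sub_sq_real, hnorm]; ring
  · have := abs_real_inner_le_norm P (V i)
    rwa [hnorm, mul_one] at this
  · rw [Fin.sum_univ_three] at hsum
    simp only [← inner_add_right, hsum, inner_zero_right]
  · have n (i) : V i 0 ^ 2 + V i 1 ^ 2 = 1 := by
      have := EuclideanSpace.real_norm_sq_eq (V i)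
      rw [hnorm, Fin.sum_univ_two] at this
      linarith
    have hP : ‖P‖ ^ 2 = P 0 ^ 2 + P 1 ^ 2 := by
      rw [EuclideanSpace.real_norm_sq_eq, Fin.sum_univ_two]
    have hI (i) : inner ℝ P (V i) = P 0 * V i 0 + P 1 * V i 1 := by
      simp [PiLp.inner_apply, Fin.sum_univ_two]; ring
    have s (j : Fin 2) : V 0 j + V 1 j + V 2 j = 0 := by
      have := congrArg (fun v : Rd 2 => v j) hsum
      simpa [Fin.sum_univ_three] using this
    simp only [hI, hP]
    have n0 := n 0
    have n1 := n 1
    have n2 := n 2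
    have e0 : V 2 0 = -(V 0 0 + V 1 0) := by linarith [s 0]
    have e1 : V 2 1 = -(V 0 1 + V 1 1) := by linarith [s 1]
    rw [e0, e1] at n2 ⊢
    generalize V 0 0 = a at *
    generalize V 0 1 = b at *
    generalize V 1 0 = c at *
    generalize V 1 1 = d at *
    generalize P 0 = p at *
    generalize P 1 = q at *
    have hc : a * c + b * d = -1/2 := by nlinarith
    have key : (p^2+q^2) * ((a^2+b^2)*(c^2+d^2) - (a*c+b*d)^2) = (p*a+q*b)^2*(c^2+d^2)
      - 2 * (p*a+q*b)*(p*c+q*d)*(a*c+b*d) + (p*c+q*d)^2*(a^2+b^2) := by ring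
    rw [n0, n1, hc] at key
    linarith

lemma aux_local (V : Fin 3 → Rd 2)
    (hnorm : ∀ i, ‖V i‖ = 1) (hsum : (∑ i, V i) = 0) (P : Rd 2) (hP : ‖P‖ ≤ 1 / 6) :
    3 + 3 / 4 * ‖P‖ ^ 2 - 82 * ‖P‖ ^ 3 ≤ ∑ i, dist P (V i) := by
  obtain ⟨x, h1, h2, h3, h4⟩ := aux_geo V hnorm hsum P
  have t0 := norm_nonneg P
  generalize ‖P‖ = t at *
  have hu (i) : |t ^ 2 - 2 * x i| ≤ 3 * t := by
    have := abs_le.1 (h2 i)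
    rw [abs_le]; constructor <;> nlinarith
  have hd (i) : 1 + (t ^ 2 - 2 * x i) / 2 - (t ^ 2 - 2 * x i) ^ 2 / 8 - 27 * t ^ 3 ≤ dist P (V i) := by
    have := aux_sqrt _ _ dist_nonneg (h1 i) (by linarith [hu i])
    have h3 := pow_le_pow_left₀ (abs_nonneg _) (hu i) 3
    nlinarith
  rw [Fin.sum_univ_three]
  have a0 := hd 0
  have a1 := hd 1
  have a2 := hd 2
  have : t ^ 4 ≤ t ^ 3 := by nlinarith [pow_nonneg t0 3]
  have e : (t ^ 2 - 2 * x 0) ^ 2 + (t ^ 2 - 2 * x 1) ^ 2 + (t ^ 2 - 2 * x 2) ^ 2 = 3 * t ^ 4 + 6 * t ^ 2 := by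
    linear_combination 4 * h4 - 4 * t ^ 2 * h3
  nlinarith [pow_nonneg t0 3]

lemma aux_upper (V : Fin 3 → Rd 2)
    (hnorm : ∀ i, ‖V i‖ = 1) (hsum : (∑ i, V i) = 0) (P : Rd 2) :
    ∑ i, dist P (V i) ≤ 3 + 3 / 2 * ‖P‖ ^ 2 := by
  obtain ⟨x, h1, h2, h3, h4⟩ := aux_geo V hnorm hsum P
  have hd (i) : dist P (V i) ≤ 1 + (‖P‖ ^ 2 - 2 * x i) / 2 := by
    nlinarith [h1 i, sq_nonneg (dist P (V i) - 1)]
  rw [Fin.sum_univ_three]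
  linarith [hd 0, hd 1, hd 2]

lemma aux_global (V : Fin 3 → Rd 2)
    (hnorm : ∀ i, ‖V i‖ = 1) (hsum : (∑ i, V i) = 0) (ρ : ℝ) (h0 : 0 < ρ) (h1 : ρ ≤ 1 / 120)
    (P : Rd 2) (hP : ρ ≤ ‖P‖) :
    3 + 3 / 4 * ρ ^ 2 - 82 * ρ ^ 3 ≤ ∑ i, dist P (V i) := by
  have hp : 0 < ‖P‖ := h0.trans_le hP
  set s := ρ / ‖P‖ with hs
  have s0 : 0 < s := by positivity
  have s1 : s ≤ 1 := (div_le_one hp).2 hP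
  have hn : ‖s • P‖ = ρ := by
    rw [norm_smul, Real.norm_of_nonneg s0.le, hs]; field_simp
  have hl := aux_local V hnorm hsum (s • P) (by rw [hn]; linarith)
  rw [hn] at hl
  have hd (i) : dist (s • P) (V i) ≤ s * dist P (V i) + (1 - s) := by
    rw [dist_eq_norm, dist_eq_norm]
    calc ‖s • P - V i‖ = ‖s • (P - V i) + (-(1 - s)) • V i‖ := by congr 1; module
      _ ≤ _ := norm_add_le _ _
      _ = _ := by
        rw [norm_smul, norm_smul, hnorm, norm_neg, Real.norm_of_nonneg s0.le,
          Real.norm_of_nonneg (by linarith)]; ring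
  rw [Fin.sum_univ_three] at *
  have a0 := hd 0
  have a1 := hd 1
  have a2 := hd 2
  have hE : 0 ≤ 3 / 4 * ρ ^ 2 - 82 * ρ ^ 3 := by nlinarith [sq_nonneg ρ]
  generalize dist P (V 0) = y0 at *
  generalize dist P (V 1) = y1 at *
  generalize dist P (V 2) = y2 at *
  have hk : 3 / 4 * ρ ^ 2 - 82 * ρ ^ 3 ≤ s * (y0 + y1 + y2 - 3) := by nlinarith
  by_contra! hcon
  nlinarith

/-- Steiner estimate. Let `V₁, V₂, V₃` be the vertices of an
equilateral triangle inscribed in the unit circle of `ℝ²` (`‖V i‖ = 1`, `∑ V i = 0`).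
For `P ∈ ℝ²` let `Σ_P = ∑ |P − V_i|` and `ℓ(ρ) = inf {Σ_P : |P| ≥ ρ}`. Then
`liminf_{ρ→0⁺} (ℓ(ρ) − 3)/ρ² ≥ 3/4`. -/
theorem steiner_lower_bound (V : Fin 3 → Rd 2)
    (hnorm : ∀ i, ‖V i‖ = 1) (hsum : (∑ i, V i) = 0) :
    (3 / 4 : ℝ) ≤ Filter.liminf
      (fun ρ : ℝ =>
        (sInf {s : ℝ | ∃ P : Rd 2, ρ ≤ ‖P‖ ∧ s = ∑ i, dist P (V i)} - 3) / ρ ^ 2)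
      (𝓝[>] (0 : ℝ)) := by
  have ev : ∀ᶠ ρ : ℝ in 𝓝[>] (0 : ℝ), 0 < ρ ∧ ρ ≤ 1 / 120 := by
    filter_upwards [Ioc_mem_nhdsGT (show (0 : ℝ) < 1 / 120 by norm_num)] with ρ h using h
  have hlow : ∀ᶠ ρ : ℝ in 𝓝[>] (0 : ℝ), 3 / 4 - 82 * ρ ≤
      (sInf {s : ℝ | ∃ P : Rd 2, ρ ≤ ‖P‖ ∧ s = ∑ i, dist P (V i)} - 3) / ρ ^ 2 := by
    filter_upwards [ev] with ρ ⟨h0, h1⟩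
    rw [le_div_iff₀ (by positivity)]
    have : 3 + 3 / 4 * ρ ^ 2 - 82 * ρ ^ 3 ≤
        sInf {s : ℝ | ∃ P : Rd 2, ρ ≤ ‖P‖ ∧ s = ∑ i, dist P (V i)} := by
      apply le_csInf
      · exact ⟨_, ρ • V 0, by rw [norm_smul, hnorm, Real.norm_of_nonneg h0.le, mul_one], rfl⟩
      · rintro _ ⟨P, hP, rfl⟩
        exact aux_global V hnorm hsum ρ h0 h1 P hP
    linarith
  have hup : ∀ᶠ ρ : ℝ in 𝓝[>] (0 : ℝ),
      (sInf {s : ℝ | ∃ P : Rd 2, ρ ≤ ‖P‖ ∧ s = ∑ i, dist P (V i)} - 3) / ρ ^ 2 ≤ 3 / 2 := by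
    filter_upwards [ev] with ρ ⟨h0, h1⟩
    rw [div_le_iff₀ (by positivity)]
    have hn : ‖ρ • V 0‖ = ρ := by rw [norm_smul, hnorm, Real.norm_of_nonneg h0.le, mul_one]
    have h := aux_upper V hnorm hsum (ρ • V 0)
    rw [hn] at h
    have : sInf {s : ℝ | ∃ P : Rd 2, ρ ≤ ‖P‖ ∧ s = ∑ i, dist P (V i)} ≤
        ∑ i, dist (ρ • V 0) (V i) := by
      apply csInf_le
      · refine ⟨0, ?_⟩
        rintro _ ⟨P, hP, rfl⟩
        exact Finset.sum_nonneg fun i _ => dist_nonneg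
      · exact ⟨ρ • V 0, hn.ge, rfl⟩
    linarith
  apply le_of_forall_lt
  intro c hc
  obtain ⟨c', hc1, hc2⟩ := exists_between hc
  refine hc1.trans_le (le_liminf_of_le ?_ ?_)
  · exact (isBoundedUnder_of_eventually_le hup).isCoboundedUnder_ge
  · filter_upwards [hlow, Ioc_mem_nhdsGT (show (0 : ℝ) < (3 / 4 - c') / 82 by linarith)] with ρ h1 h2
    have := h2.2
    rw [le_div_iff₀ (by norm_num)] at this
    linarith
end
end

section
/- Let d ≥ 2 and let H := {x ∈ ℝ^d : x_d > 0} be an open half-space. Then the 2-partition (H, ℝ^d \ H) of ℝ^d is locally isoperimetric. -/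
open MeasureTheory Metric Set Filter Bornology
open scoped ENNReal symmDiff Topology

noncomputable section

/-- Divergence of a vector field on `ℝ^d`. -/
def vdiv {d : ℕ} (φ : Rd d → Rd d) (x : Rd d) : ℝ :=
  ∑ i : Fin d, fderiv ℝ φ x (EuclideanSpace.single i (1 : ℝ)) i

/-- Relative perimeter of a set `E` in an open set `U`:
the supremum of `∫_E div φ` over `C¹` vector fields `φ` compactly supported in `U`
with `‖φ‖ ≤ 1`. -/
def perimOpen {d : ℕ} (E U : Set (Rd d)) : ℝ≥0∞ :=
  ⨆ (φ : Rd d → Rd d) (_ : ContDiff ℝ 1 φ) (_ : HasCompactSupport φ)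
      (_ : tsupport φ ⊆ U) (_ : ∀ x, ‖φ x‖ ≤ 1),
    ENNReal.ofReal (∫ x in E, vdiv φ x)

/-- Relative perimeter of `E` in an arbitrary set `A`, extended (by outer regularity)
from the values on open sets; this is the Borel measure `|D1_E|` evaluated at `A`. -/
def perim {d : ℕ} (E A : Set (Rd d)) : ℝ≥0∞ :=
  ⨅ (U : Set (Rd d)) (_ : IsOpen U) (_ : A ⊆ U), perimOpen E U

/-- Perimeter of a partition: half of the sum of the relative perimeters of the regions. -/
def partPerim {d N : ℕ} (E : Fin N → Set (Rd d)) (A : Set (Rd d)) : ℝ≥0∞ :=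
  (∑ k, perim (E k) A) / 2

/-- An `N`-partition of `Ω`: measurable regions, pairwise disjoint in `Ω` up to null sets,
covering `Ω` up to a null set. Regions of measure zero are allowed (improper partitions). -/
def IsPartition {d N : ℕ} (Ω : Set (Rd d)) (E : Fin N → Set (Rd d)) : Prop :=
  (∀ k, MeasurableSet (E k)) ∧
  (∀ k j, k ≠ j → volume (E k ∩ E j ∩ Ω) = 0) ∧
  volume (Ω \ ⋃ k, E k) = 0

/-- A locally isoperimetric `N`-partition of `Ω`. -/
def LocallyIsoperimetric {d N : ℕ} (Ω : Set (Rd d)) (E : Fin N → Set (Rd d)) : Prop :=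
  IsPartition Ω E ∧
  ∀ B : Set (Rd d), IsCompact B → B ⊆ Ω →
    ∀ F : Fin N → Set (Rd d), IsPartition Ω F →
      (∀ k, volume ((E k ∆ F k) \ B) = 0) →
      (∀ k, volume (F k) = volume (E k)) →
      partPerim E B ≤ partPerim F B


/-- The integral of a directional derivative of a compactly supported `C¹` function over a set `A`
moved into itself by `v`, when translation increases the integral. -/
theorem lineInt_nonneg {d : ℕ} (A : Set (Rd d)) (hA : MeasurableSet A) (v : Rd d)
    (f : Rd d → ℝ) (hf : ContDiff ℝ 1 f) (hc : HasCompactSupport f)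
    (hmono : ∀ t : ℝ, 0 < t → ∫ x in A, f x ≤ ∫ x in A, f (x + t • v)) :
    0 ≤ ∫ x in A, fderiv ℝ f x v := by
  obtain ⟨C, hC⟩ := ContDiff.lipschitzWith_of_hasCompactSupport hc hf (by norm_num)
  have hcont : Continuous f := hf.continuous
  have hfi : Integrable f := hcont.integrable_of_hasCompactSupport hc
  obtain ⟨R, hR⟩ := hc.isCompact.isBounded.subset_closedBall (0 : Rd d)
  have hout : ∀ x : Rd d, R < ‖x‖ → f x = 0 := by
    intro x hx
    by_contra h
    have := hR (subset_tsupport f h)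
    simp at this
    linarith
  set K : Set (Rd d) := closedBall 0 (R + ‖v‖) with hK
  set g : Rd d → ℝ := (A ∩ K).indicator 1 with hg
  have hgi : Integrable g := by
    rw [hg, integrable_indicator_iff (hA.inter isClosed_closedBall.measurableSet)]
    refine integrableOn_const (C := (1 : ℝ)) ?_
    exact ((measure_mono inter_subset_right).trans_lt measure_closedBall_lt_top).ne
  have key := hC.integral_inv_smul_sub_mul_tendsto_integral_lineDeriv_mul (μ := volume) hgi v
  have hmulg : ∀ u : Rd d → ℝ, (∀ x, x ∉ K → u x = 0) →
      ∫ x, u x * g x = ∫ x in A, u x := by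
    intro u hu
    rw [← integral_indicator hA]
    congr 1
    ext x
    by_cases hxA : x ∈ A <;> by_cases hxK : x ∈ K <;> simp [hg, hxA, hxK]
    exact (hu x hxK).symm
  have hnK : ∀ x, x ∉ K → R + ‖v‖ < ‖x‖ := by
    intro x hx
    simpa [hK] using hx
  have hlim : ∫ x, lineDeriv ℝ f x v * g x = ∫ x in A, fderiv ℝ f x v := by
    have h1 : ∀ x, lineDeriv ℝ f x v = fderiv ℝ f x v := fun x =>
      (hf.differentiable (by norm_num) x).lineDeriv_eq_fderiv
    simp_rw [h1]
    apply hmulg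
    intro x hx
    have hx' := hnK x hx
    have : x ∉ tsupport f := fun h => by
      have := hR h
      simp at this
      linarith [norm_nonneg v]
    have h2 : fderiv ℝ f x = 0 := by
      by_contra h
      exact this (support_fderiv_subset ℝ h)
    simp [h2]
  rw [← hlim]
  refine ge_of_tendsto key ?_
  have h01 : Ioo (0 : ℝ) 1 ∈ 𝓝[>] (0 : ℝ) := Ioo_mem_nhdsGT one_pos
  filter_upwards [h01] with t ht
  rw [hmulg]
  · have hti : Integrable (fun x => f (x + t • v)) := hfi.comp_add_right _
    simp only [smul_eq_mul]
    rw [integral_const_mul, integral_sub hti.integrableOn hfi.integrableOn]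
    exact mul_nonneg (inv_nonneg.2 ht.1.le) (sub_nonneg.2 (hmono t ht.1))
  · intro x hx
    have hx' := hnK x hx
    have e1 : f x = 0 := hout x (by linarith [norm_nonneg v])
    have e2 : f (x + t • v) = 0 := by
      apply hout
      have h3 : ‖t • v‖ ≤ ‖v‖ := by
        rw [norm_smul, Real.norm_of_nonneg ht.1.le]
        nlinarith [norm_nonneg v, ht.2]
      have h4 : ‖x‖ ≤ ‖x + t • v‖ + ‖t • v‖ := by
        simpa using norm_sub_le (x + t • v) (t • v)
      linarith
    simp [e1, e2]

theorem setInt_translate {d : ℕ} (A : Set (Rd d)) (hA : MeasurableSet A) (w : Rd d)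
    (f : Rd d → ℝ) : ∫ x in A, f (x + w) = ∫ x in (fun x => x - w) ⁻¹' A, f x := by
  have hm : Measurable (fun x : Rd d => x - w) := by fun_prop
  rw [← integral_indicator hA, ← integral_indicator (hm hA),
    ← integral_add_right_eq_self (μ := volume) (((fun x => x - w) ⁻¹' A).indicator f) w]
  congr 1
  ext x
  have hiff : x + w ∈ (fun x => x - w) ⁻¹' A ↔ x ∈ A := by
    rw [mem_preimage, add_sub_cancel_right]
  by_cases h : x ∈ A
  · rw [indicator_of_mem h, indicator_of_mem (hiff.2 h)]
  · rw [indicator_of_notMem h, indicator_of_notMem (fun h' => h (hiff.1 h'))]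

theorem div_nonneg_aux {d : ℕ} (A : Set (Rd d)) (hA : MeasurableSet A) (j : Fin d) (s : ℝ)
    (hs : s * s = 1)
    (hinv : ∀ i, i ≠ j → ∀ (t : ℝ) (x : Rd d), x - t • EuclideanSpace.single i (1 : ℝ) ∈ A ↔ x ∈ A)
    (hj : ∀ (t : ℝ) (x : Rd d), 0 < t → x - t • (s • EuclideanSpace.single j (1 : ℝ)) ∈ A → x ∈ A)
    (χ : Rd d → Rd d) (hχ : ContDiff ℝ 1 χ) (hc : HasCompactSupport χ)
    (hneg : ∀ x, s * χ x j ≤ 0) : 0 ≤ ∫ x in A, vdiv χ x := by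
  have hcd : ∀ i, ContDiff ℝ 1 (fun x => χ x i) := fun i => by fun_prop
  have hcc : ∀ i, HasCompactSupport (fun x => χ x i) := fun i =>
    hc.comp_left (g := fun y : Rd d => y i) (by simp)
  have hfd : ∀ i x v, fderiv ℝ χ x v i = fderiv ℝ (fun x => χ x i) x v := by
    intro i x v
    have h1 : HasFDerivAt (fun x => χ x i)
        ((EuclideanSpace.proj i : Rd d →L[ℝ] ℝ).comp (fderiv ℝ χ x)) x :=
      (EuclideanSpace.proj i : Rd d →L[ℝ] ℝ).hasFDerivAt.comp x
        (hχ.differentiable (by norm_num) x).hasFDerivAt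
    rw [h1.fderiv]
    rfl
  unfold vdiv
  simp_rw [hfd]
  rw [integral_finsetSum]
  · apply Finset.sum_nonneg
    intro i _
    by_cases hij : i = j
    · subst hij
      have hrw : ∀ x, fderiv ℝ (fun x => χ x i) x (EuclideanSpace.single i (1 : ℝ)) =
          fderiv ℝ (fun x => s * χ x i) x (s • EuclideanSpace.single i (1 : ℝ)) := by
        intro x
        rw [fderiv_const_mul ((hcd i).differentiable (by norm_num) x)]
        simp only [map_smul, ContinuousLinearMap.smul_apply, smul_eq_mul]
        rw [← mul_assoc, hs, one_mul]
      simp_rw [hrw]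
      have hcd' : ContDiff ℝ 1 (fun x => s * χ x i) := by fun_prop
      have hcc' : HasCompactSupport (fun x => s * χ x i) := (hcc i).mul_left
      have hint : Integrable (fun x => s * χ x i) :=
        hcd'.continuous.integrable_of_hasCompactSupport hcc'
      refine lineInt_nonneg A hA _ _ hcd' hcc' ?_
      intro t ht
      rw [setInt_translate A hA _ (fun x => s * χ x i)]
      have hm : Measurable (fun x : Rd d => x - t • s • EuclideanSpace.single i (1 : ℝ)) := by
        fun_prop
      have := setIntegral_mono_set (μ := volume) (f := fun x => -(s * χ x i)) (t := A)
        (s := (fun x => x - t • s • EuclideanSpace.single i (1 : ℝ)) ⁻¹' A)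
        hint.neg.integrableOn (Eventually.of_forall fun x => by simpa using hneg x)
        (HasSubset.Subset.eventuallyLE fun x hx => hj t x ht hx)
      rw [integral_neg, integral_neg] at this
      linarith
    · refine lineInt_nonneg A hA _ _ (hcd i) (hcc i) ?_
      intro t ht
      rw [setInt_translate A hA _ (fun x => χ x i)]
      have : (fun x => x - t • EuclideanSpace.single i (1 : ℝ)) ⁻¹' A = A := by
        ext x
        exact hinv i hij t x
      rw [this]
  · intro i _
    apply Integrable.integrableOn
    apply Continuous.integrable_of_hasCompactSupport
    · exact ((hcd i).continuous_fderiv (by norm_num)).clm_apply continuous_const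
    · exact (hcc i).fderiv_apply (𝕜 := ℝ) _

theorem perimOpen_le_aux {d : ℕ} (A : Set (Rd d)) (hA : MeasurableSet A) (j : Fin d) (s : ℝ)
    (hs : s * s = 1)
    (hinv : ∀ i, i ≠ j → ∀ (t : ℝ) (x : Rd d), x - t • EuclideanSpace.single i (1 : ℝ) ∈ A ↔ x ∈ A)
    (hj : ∀ (t : ℝ) (x : Rd d), 0 < t → x - t • (s • EuclideanSpace.single j (1 : ℝ)) ∈ A → x ∈ A)
    (F B U : Set (Rd d)) (hF : MeasurableSet F) (hB : IsCompact B) (hU : IsOpen U) (hBU : B ⊆ U)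
    (hAF : volume ((A ∆ F) \ B) = 0) : perimOpen A U ≤ perimOpen F U := by
  have habs : |s| = 1 := by
    rcases mul_self_eq_one_iff.1 hs with h | h <;> simp [h]
  unfold perimOpen
  refine iSup_le fun φ => iSup_le fun h1 => iSup_le fun h2 => iSup_le fun h3 => iSup_le fun h4 => ?_
  obtain ⟨T, hT, hKT, hTU⟩ := exists_compact_between (hB.union h2.isCompact) hU
    (union_subset hBU h3)
  obtain ⟨η, hη1, hη0, hη⟩ := exists_contMDiffMap_one_nhds_of_subset_interior
    (modelWithCornersSelf ℝ (Rd d)) (n := 1) (hB.union h2.isCompact).isClosed hKT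
  have hηd : ContDiff ℝ 1 η := η.contMDiff.contDiff
  set ψ : Rd d → Rd d := fun x => (-s * η x) • EuclideanSpace.single j (1 : ℝ) with hψ
  have hψd : ContDiff ℝ 1 ψ := by fun_prop
  have hψz : ∀ x, x ∉ T → ψ x = 0 := by
    intro x hx
    simp [hψ, hη0 x hx]
  have hψt : tsupport ψ ⊆ T := by
    refine closure_minimal ?_ hT.isClosed
    intro x hx
    by_contra h
    exact hx (hψz x h)
  have hψc : HasCompactSupport ψ := HasCompactSupport.intro hT hψz
  have hψn : ∀ x, ‖ψ x‖ ≤ 1 := by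
    intro x
    simp only [hψ, norm_smul, norm_mul, norm_neg, Real.norm_eq_abs, habs, one_mul,
      EuclideanSpace.norm_single, abs_one, mul_one]
    rw [abs_of_nonneg (hη x).1]
    exact (hη x).2
  refine le_trans (ENNReal.ofReal_le_ofReal ?_) (le_iSup_of_le ψ (le_iSup_of_le hψd
    (le_iSup_of_le hψc (le_iSup_of_le (hψt.trans hTU) (le_iSup_of_le hψn le_rfl)))))
  -- integral over F equals the integral over A
  have hFA : ∫ x in F, vdiv ψ x = ∫ x in A, vdiv ψ x := by
    rw [← integral_indicator hF, ← integral_indicator hA]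
    apply integral_congr_ae
    have : ∀ᵐ x, x ∉ (A ∆ F) \ B := measure_eq_zero_iff_ae_notMem.1 hAF
    filter_upwards [this] with x hx
    by_cases hxB : x ∈ B
    · have hz : vdiv ψ x = 0 := by
        have hev : ψ =ᶠ[𝓝 x] fun _ => (-s) • EuclideanSpace.single j (1 : ℝ) := by
          have := (eventually_nhdsSet_iff_forall.1 hη1) x (Or.inl hxB)
          filter_upwards [this] with y hy
          simp [hψ, hy]
        unfold vdiv
        rw [hev.fderiv_eq]
        simp
      simp [indicator, hz]
    · have : x ∈ A ↔ x ∈ F := by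
        simp only [mem_diff, mem_symmDiff] at hx
        tauto
      by_cases h : x ∈ A
      · rw [indicator_of_mem h, indicator_of_mem (this.1 h)]
      · rw [indicator_of_notMem h, indicator_of_notMem (fun h' => h (this.2 h'))]
  rw [hFA]
  have hint : ∀ χ : Rd d → Rd d, ContDiff ℝ 1 χ → HasCompactSupport χ → Integrable (vdiv χ) := by
    intro χ c1 c2
    unfold vdiv
    refine integrable_finsetSum _ fun i _ => ?_
    apply Continuous.integrable_of_hasCompactSupport
    · have := (c1.continuous_fderiv (by norm_num)).clm_apply
        (continuous_const (y := EuclideanSpace.single i (1 : ℝ)))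
      fun_prop
    · exact (c2.fderiv_apply (𝕜 := ℝ) (EuclideanSpace.single i (1 : ℝ))).comp_left
        (g := fun y : Rd d => y i) (by simp)
  have hmain := div_nonneg_aux A hA j s hs hinv hj (ψ - φ) (hψd.sub h1) (hψc.sub h2) ?_
  · have hsub : ∀ x, vdiv (ψ - φ) x = vdiv ψ x - vdiv φ x := by
      intro x
      unfold vdiv
      rw [fderiv_sub (hψd.differentiable (by norm_num) x) (h1.differentiable (by norm_num) x)]
      simp
    simp_rw [hsub] at hmain
    rw [integral_sub (hint ψ hψd hψc).integrableOn (hint φ h1 h2).integrableOn] at hmain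
    linarith
  · intro x
    have e : s * (ψ - φ) x j = -η x - s * φ x j := by
      simp [hψ]
      linear_combination (-η x) * hs
    rw [e]
    by_cases hx : x ∈ tsupport φ
    · have hx1 : η x = 1 := ((eventually_nhdsSet_iff_forall.1 hη1) x (Or.inr hx)).self_of_nhds
      have h5 : |φ x j| ≤ 1 := (by simpa using PiLp.norm_apply_le (φ x) j : |φ x j| ≤ ‖φ x‖).trans (h4 x)
      have h6 : |s * φ x j| ≤ 1 := by rw [abs_mul, habs, one_mul]; exact h5
      rw [hx1]
      linarith [(abs_le.1 h6).1]
    · rw [image_eq_zero_of_notMem_tsupport hx]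
      simpa using (hη x).1

theorem halfSpace_locallyIsoperimetric (d : ℕ) (hd : 2 ≤ d) :
    LocallyIsoperimetric Set.univ
      ![{x : Rd d | 0 < x ⟨d - 1, by omega⟩}, {x : Rd d | 0 < x ⟨d - 1, by omega⟩}ᶜ] := by
  generalize (⟨d - 1, by omega⟩ : Fin d) = j
  have hH : MeasurableSet {x : Rd d | 0 < x j} :=
    measurableSet_lt measurable_const (by fun_prop)
  refine ⟨⟨?_, ?_, ?_⟩, ?_⟩
  · intro k
    fin_cases k
    · exact hH
    · exact hH.compl
  · intro k l hkl
    fin_cases k <;> fin_cases l <;> simp at hkl ⊢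
  · have hu : (⋃ k, ![{x : Rd d | 0 < x j}, {x : Rd d | 0 < x j}ᶜ] k) = univ := by
      refine eq_univ_of_forall fun x => mem_iUnion.2 ?_
      by_cases hx : x ∈ {x : Rd d | 0 < x j}
      · exact ⟨0, hx⟩
      · exact ⟨1, hx⟩
    rw [hu]
    simp
  · intro B hB _ F hF hsym _
    unfold partPerim
    refine ENNReal.div_le_div_right (Finset.sum_le_sum fun k _ => ?_) _
    unfold perim
    refine le_iInf fun U => le_iInf fun hU => le_iInf fun hBU =>
      iInf_le_of_le U (iInf_le_of_le hU (iInf_le_of_le hBU ?_))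
    have hk := hsym k
    have hm := hF.1 k
    generalize F k = G at hk hm
    fin_cases k
    · refine perimOpen_le_aux _ hH j 1 (by norm_num) ?_ ?_ G B U hm hB hU hBU hk
      · intro i hi t x
        simp [hi.symm]
      · intro t x ht hx
        simp at hx ⊢
        linarith
    · refine perimOpen_le_aux _ hH.compl j (-1) (by norm_num) ?_ ?_ G B U hm hB hU hBU hk
      · intro i hi t x
        simp [hi.symm]
      · intro t x ht hx
        simp at hx ⊢
        linarith
end
end

section
/- In the plane ℝ², identify points with polar coordinates and let E_1, E_2, E_3 be the three open sectors of opening angle 2π/3 with common vertex at the origin, namely E_k := { r(cos θ, sin θ) : r > 0, θ ∈ ((k−1)·2π/3, k·2π/3) } for k = 1, 2, 3. Then the triple junction partition (E_1, E_2, E_3) is a locally isoperimetric 3-partition of ℝ². -/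
open MeasureTheory Metric Set Filter Bornology
open scoped ENNReal symmDiff Topology

noncomputable section

/-- The three open sectors of opening angle `2π/3` with common vertex at the origin:
`E_k = { r(cos θ, sin θ) : r > 0, θ ∈ (k·2π/3, (k+1)·2π/3) }` for `k = 0, 1, 2`
(equivalently, `θ ∈ ((k−1)·2π/3, k·2π/3)` for `k = 1, 2, 3`). -/
def tripleJunction (k : Fin 3) : Set (Rd 2) :=
  {x | ∃ r θ : ℝ, 0 < r ∧
    ((k : ℕ) : ℝ) * (2 * Real.pi / 3) < θ ∧ θ < (((k : ℕ) : ℝ) + 1) * (2 * Real.pi / 3) ∧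
    x 0 = r * Real.cos θ ∧ x 1 = r * Real.sin θ}

theorem vdiv_coord {d : ℕ} {φ : Rd d → Rd d} (hφ : ContDiff ℝ 1 φ) (x : Rd d) :
    vdiv φ x = ∑ i : Fin d, fderiv ℝ (fun y => φ y i) x (EuclideanSpace.single i (1 : ℝ)) := by
  unfold vdiv
  refine Finset.sum_congr rfl fun i _ => ?_
  have h := (EuclideanSpace.proj i : Rd d →L[ℝ] ℝ).hasFDerivAt.comp x
    ((hφ.differentiable one_ne_zero) x).hasFDerivAt
  have h2 : HasFDerivAt (fun y => φ y i) _ x := h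
  rw [h2.fderiv]; rfl

theorem vdiv_continuous {d : ℕ} {φ : Rd d → Rd d} (hφ : ContDiff ℝ 1 φ) :
    Continuous (vdiv φ) := by
  have h := hφ.continuous_fderiv one_ne_zero
  unfold vdiv
  fun_prop

theorem vdiv_hasCompactSupport {d : ℕ} {φ : Rd d → Rd d} (hc : HasCompactSupport φ) :
    HasCompactSupport (vdiv φ) := by
  have := hc.fderiv (𝕜 := ℝ)
  refine this.mono fun x hx => ?_
  contrapose! hx
  simp only [Function.mem_support, not_not] at hx ⊢
  simp [vdiv, hx]

theorem vdiv_integrable {d : ℕ} {φ : Rd d → Rd d} (hφ : ContDiff ℝ 1 φ)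
    (hc : HasCompactSupport φ) : Integrable (vdiv φ) :=
  (vdiv_continuous hφ).integrable_of_hasCompactSupport (vdiv_hasCompactSupport hc)

theorem vdiv_smul_const {d : ℕ} {η : Rd d → ℝ} (hη : ContDiff ℝ 1 η) (w : Rd d) (x : Rd d) :
    vdiv (fun y => η y • w) x = fderiv ℝ η x w := by
  have h : HasFDerivAt (fun y => η y • w) _ x :=
    ((hη.differentiable one_ne_zero) x).hasFDerivAt.smul_const w
  unfold vdiv
  rw [h.fderiv]
  conv_rhs => rw [← (EuclideanSpace.basisFun (Fin d) ℝ).sum_repr w, map_sum]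
  refine Finset.sum_congr rfl fun i _ => ?_
  simp [mul_comm]

/-- integration by parts -/
theorem ibp {d : ℕ} {u : Rd d → ℝ} {φ : Rd d → Rd d} (hu : ContDiff ℝ 1 u)
    (hφ : ContDiff ℝ 1 φ) (hc : HasCompactSupport φ) :
    ∫ x, u x * vdiv φ x = - ∫ x, fderiv ℝ u x (φ x) := by
  have hdu := hu.continuous_fderiv one_ne_zero
  have hci : ∀ i, HasCompactSupport (fun y => φ y i) := fun i =>
    hc.comp_left (g := fun v : Rd d => v i) rfl
  have hφi : ∀ i, ContDiff ℝ 1 (fun y => φ y i) := fun i =>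
    (EuclideanSpace.proj i : Rd d →L[ℝ] ℝ).contDiff.comp hφ
  have hdφ : ∀ i, Continuous (fderiv ℝ (fun y => φ y i)) := fun i =>
    (hφi i).continuous_fderiv one_ne_zero
  have i1 : ∀ i, Integrable (fun x => fderiv ℝ u x (EuclideanSpace.single i (1:ℝ)) * φ x i) := by
    intro i
    have := (hφi i).continuous
    exact Continuous.integrable_of_hasCompactSupport (by fun_prop) (hci i).mul_left
  have i2 : ∀ i, Integrable (fun x => u x *
      fderiv ℝ (fun y => φ y i) x (EuclideanSpace.single i (1:ℝ))) := by
    intro i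
    have h1 := hu.continuous
    have := hdφ i
    refine Continuous.integrable_of_hasCompactSupport (by fun_prop) ?_
    exact ((hci i).fderiv_apply (𝕜 := ℝ) _).mul_left
  have key : ∀ i, _ := fun i => integral_mul_fderiv_eq_neg_fderiv_mul_of_integrable (i1 i) (i2 i)
    (Continuous.integrable_of_hasCompactSupport (hu.continuous.mul (hφi i).continuous)
      (hci i).mul_left) (fun x _ => hu.differentiable one_ne_zero x)
      (fun x _ => (hφi i).differentiable one_ne_zero x)
  simp_rw [vdiv_coord hφ, Finset.mul_sum]
  rw [integral_finsetSum _ fun i _ => i2 i]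
  have : ∀ x, fderiv ℝ u x (φ x) =
      ∑ i, fderiv ℝ u x (EuclideanSpace.single i (1:ℝ)) * φ x i := by
    intro x
    conv_lhs => rw [← (EuclideanSpace.basisFun (Fin d) ℝ).sum_repr (φ x), map_sum]
    refine Finset.sum_congr rfl fun i _ => ?_
    simp [mul_comm]
  simp_rw [this]
  rw [integral_finsetSum _ fun i _ => i1 i, ← Finset.sum_neg_distrib]
  exact Finset.sum_congr rfl fun i _ => key i

theorem perimOpen_ge {d : ℕ} {F U : Set (Rd d)} (hfin : perimOpen F U ≠ ∞) {φ : Rd d → Rd d}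
    (hφ : ContDiff ℝ 1 φ) (hc : HasCompactSupport φ) (hs : tsupport φ ⊆ U)
    (hn : ∀ x, ‖φ x‖ ≤ 1) : ∫ x in F, vdiv φ x ≤ (perimOpen F U).toReal := by
  rw [← ENNReal.ofReal_le_iff_le_toReal hfin]
  unfold perimOpen
  exact le_iSup₂_of_le φ hφ (le_iSup₂_of_le hc hs (le_iSup_of_le hn le_rfl))

theorem perimOpen_approx {d : ℕ} {F U : Set (Rd d)} (hfin : perimOpen F U ≠ ∞) {δ : ℝ}
    (hδ : 0 < δ) : ∃ φ : Rd d → Rd d, ContDiff ℝ 1 φ ∧ HasCompactSupport φ ∧ tsupport φ ⊆ U ∧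
    (∀ x, ‖φ x‖ ≤ 1) ∧ (perimOpen F U).toReal - δ ≤ ∫ x in F, vdiv φ x := by
  by_contra! hcon
  have h0 : (perimOpen F U) ≤ ENNReal.ofReal ((perimOpen F U).toReal - δ) := by
    conv_lhs => unfold perimOpen
    refine iSup_le fun φ => iSup_le fun h1 => iSup_le fun h2 => iSup_le fun h3 => iSup_le fun h4 => ?_
    exact ENNReal.ofReal_le_ofReal (hcon φ h1 h2 h3 h4).le
  have h1 := ENNReal.toReal_mono ENNReal.ofReal_ne_top h0
  have h2 := hcon 0 contDiff_const HasCompactSupport.zero (by simp [tsupport]) (by simp)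
  have h3 : vdiv (0 : Rd d → Rd d) = 0 := by
    funext x; simp [vdiv]
  rw [h3] at h2
  simp only [Pi.zero_apply, integral_zero] at h2
  rw [ENNReal.toReal_ofReal h2.le] at h1
  linarith

/-- mollified indicator -/
def moll {d : ℕ} (b : ContDiffBump (0 : Rd d)) (F : Set (Rd d)) : Rd d → ℝ :=
  MeasureTheory.convolution (b.normed volume) (F.indicator (fun _ => (1:ℝ)))
    (ContinuousLinearMap.lsmul ℝ ℝ) volume

theorem ind_li {d : ℕ} {F : Set (Rd d)} (hF : MeasurableSet F) :
    LocallyIntegrable (F.indicator (fun _ => (1:ℝ))) (volume : Measure (Rd d)) :=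
  (locallyIntegrable_const (1:ℝ)).indicator hF

theorem moll_contDiff {d : ℕ} (b : ContDiffBump (0 : Rd d)) {F : Set (Rd d)}
    (hF : MeasurableSet F) : ContDiff ℝ 2 (moll b F) := by
  have := b.hasCompactSupport_normed (μ := volume).contDiff_convolution_left
    (ContinuousLinearMap.lsmul ℝ ℝ) (n := 2) b.contDiff_normed (ind_li hF)
  exact this

theorem moll_eq {d : ℕ} (b : ContDiffBump (0 : Rd d)) (F : Set (Rd d)) (x : Rd d) :
    moll b F x = ∫ t, b.normed volume (x - t) * F.indicator (fun _ => (1:ℝ)) t := by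
  unfold moll
  rw [convolution_eq_swap]; rfl

theorem bump_int {d : ℕ} (b : ContDiffBump (0 : Rd d)) (x : Rd d) :
    Integrable (fun t => b.normed volume (x - t)) :=
  (b.continuous_normed.integrable_of_hasCompactSupport b.hasCompactSupport_normed).comp_sub_left x

theorem moll_int {d : ℕ} (b : ContDiffBump (0 : Rd d)) {F : Set (Rd d)} (hF : MeasurableSet F)
    (x : Rd d) :
    Integrable (fun t => b.normed volume (x - t) * F.indicator (fun _ => (1:ℝ)) t) := by
  have := (bump_int b x).indicator hF
  refine this.congr (Eventually.of_forall fun t => ?_)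
  by_cases h : t ∈ F <;> simp [h]

theorem moll_nonneg {d : ℕ} (b : ContDiffBump (0 : Rd d)) (F : Set (Rd d)) (x : Rd d) :
    0 ≤ moll b F x := by
  rw [moll_eq]
  refine integral_nonneg fun t => mul_nonneg (b.nonneg_normed _) ?_
  exact indicator_nonneg (fun _ _ => zero_le_one) _

theorem bump_total {d : ℕ} (b : ContDiffBump (0 : Rd d)) (x : Rd d) :
    ∫ t, b.normed volume (x - t) = 1 := by
  rw [integral_sub_left_eq_self (fun t => b.normed volume t) volume x]
  exact b.integral_normed

theorem moll_le_one {d : ℕ} (b : ContDiffBump (0 : Rd d)) {F : Set (Rd d)} (hF : MeasurableSet F)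
    (x : Rd d) : moll b F x ≤ 1 := by
  rw [moll_eq]
  refine le_trans ?_ (bump_total b x).le
  refine integral_mono (moll_int b hF x) (bump_int b x) fun t => ?_
  refine mul_le_of_le_one_right (b.nonneg_normed _) ?_
  exact indicator_le_self' (fun _ _ => zero_le_one) _

theorem ind_sum {d N : ℕ} {F : Fin N → Set (Rd d)} (hF : IsPartition Set.univ F) :
    ∀ᵐ x, ∑ k, (F k).indicator (fun _ => (1:ℝ)) x = 1 := by
  obtain ⟨_, h1, h2⟩ := hF
  have a1 : ∀ k j, ∀ᵐ x, k ≠ j → ¬ (x ∈ F k ∧ x ∈ F j) := by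
    intro k j
    by_cases hkj : k = j
    · simp [hkj]
    · have := h1 k j hkj
      rw [inter_univ] at this
      filter_upwards [measure_eq_zero_iff_ae_notMem.1 this] with x hx _ using hx
  have a2 : ∀ᵐ x, x ∈ ⋃ k, F k := by
    filter_upwards [measure_eq_zero_iff_ae_notMem.1 h2] with x hx
    simpa using hx
  have a1' : ∀ᵐ x, ∀ k j, k ≠ j → ¬ (x ∈ F k ∧ x ∈ F j) := by
    rw [ae_all_iff]; intro k; rw [ae_all_iff]; exact a1 k
  filter_upwards [a1', a2] with x hx1 hx2
  obtain ⟨k, hk⟩ := mem_iUnion.1 hx2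
  rw [Finset.sum_eq_single k]
  · simp [hk]
  · intro j _ hj
    have : x ∉ F j := fun h => hx1 j k hj ⟨h, hk⟩
    simp [this]
  · simp

theorem moll_sum {d N : ℕ} (b : ContDiffBump (0 : Rd d)) {F : Fin N → Set (Rd d)}
    (hF : IsPartition Set.univ F) (x : Rd d) : ∑ k, moll b (F k) x = 1 := by
  simp_rw [moll_eq]
  rw [← integral_finsetSum _ fun k _ => moll_int b (hF.1 k) x]
  refine Eq.trans ?_ (bump_total b x)
  refine integral_congr_ae ?_
  filter_upwards [ind_sum hF] with t ht
  rw [← Finset.mul_sum, ht, mul_one]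

theorem bump_even {d : ℕ} (b : ContDiffBump (0 : Rd d)) (x y : Rd d) :
    b.normed volume (x - y) = b.normed volume (y - x) := by
  rw [← neg_sub, b.normed_neg]

/-- Fubini -/
theorem moll_fubini {d : ℕ} (b : ContDiffBump (0 : Rd d)) {F : Set (Rd d)} (hF : MeasurableSet F)
    {h : Rd d → ℝ} (hh : Continuous h) (hc : HasCompactSupport h) :
    ∫ x, moll b F x * h x = ∫ x in F, ∫ t, b.normed volume (x - t) * h t := by
  simp_rw [moll_eq, ← integral_mul_const]
  rw [← integral_indicator hF]
  have hint : Integrable (Function.uncurry fun (x t : Rd d) =>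
      b.normed volume (x - t) * F.indicator (fun _ => (1:ℝ)) t * h x)
      ((volume : Measure (Rd d)).prod volume) := by
    have h1 : Integrable (Function.uncurry fun (x t : Rd d) => b.normed volume (x - t) * h x)
        ((volume : Measure (Rd d)).prod volume) := by
      have hb := b.continuous_normed (μ := volume)
      refine Continuous.integrable_of_hasCompactSupport (by
        unfold Function.uncurry; fun_prop) ?_
      have hK := hc.isCompact.prod (hc.isCompact.add (isCompact_closedBall (0 : Rd d) b.rOut))
      refine HasCompactSupport.intro hK ?_
      rintro ⟨x, t⟩ hxt
      by_contra hne
      simp only [Function.uncurry] at hne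
      have hx : x ∈ tsupport h := subset_tsupport _ (right_ne_zero_of_mul hne)
      have ht : t - x ∈ Function.support (b.normed volume) := by
        rw [Function.mem_support, bump_even b t x]
        exact left_ne_zero_of_mul hne
      rw [b.support_normed_eq] at ht
      exact hxt ⟨hx, x, hx, t - x, ball_subset_closedBall ht, by simp⟩
    have h2 := h1.indicator (measurable_snd hF)
    refine h2.congr (Eventually.of_forall fun p => ?_)
    obtain ⟨x, t⟩ := p
    by_cases ht : t ∈ F
    · simp [Function.uncurry, ht]
    · simp [Function.uncurry, ht]
  rw [integral_integral_swap hint]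
  refine integral_congr_ae (Eventually.of_forall fun t => ?_)
  by_cases ht : t ∈ F
  · simp only [ht, indicator_of_mem, mul_one]
    simp_rw [bump_even b t]
  · simp [ht]

/-- mollified field -/
def vmoll {d : ℕ} (b : ContDiffBump (0 : Rd d)) (φ : Rd d → Rd d) : Rd d → Rd d :=
  MeasureTheory.convolution (b.normed volume) φ (ContinuousLinearMap.lsmul ℝ ℝ) volume

theorem vmoll_contDiff {d : ℕ} (b : ContDiffBump (0 : Rd d)) {φ : Rd d → Rd d}
    (hφ : ContDiff ℝ 1 φ) : ContDiff ℝ 1 (vmoll b φ) :=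
  b.hasCompactSupport_normed (μ := volume).contDiff_convolution_left
    (ContinuousLinearMap.lsmul ℝ ℝ) (n := 1) b.contDiff_normed hφ.continuous.locallyIntegrable

theorem vmoll_norm {d : ℕ} (b : ContDiffBump (0 : Rd d)) {φ : Rd d → Rd d}
    (hn : ∀ x, ‖φ x‖ ≤ 1) (x : Rd d) : ‖vmoll b φ x‖ ≤ 1 := by
  unfold vmoll
  rw [convolution_eq_swap]
  refine (norm_integral_le_of_norm_le (bump_int b x) (Eventually.of_forall fun t => ?_)).trans
    (bump_total b x).le
  simp only [ContinuousLinearMap.lsmul_apply, norm_smul]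
  rw [Real.norm_of_nonneg (b.nonneg_normed _)]
  exact mul_le_of_le_one_right (b.nonneg_normed _) (hn t)

theorem vmoll_tsupport {d : ℕ} (b : ContDiffBump (0 : Rd d)) {φ : Rd d → Rd d} :
    tsupport (vmoll b φ) ⊆ Metric.cthickening b.rOut (tsupport φ) := by
  refine closure_minimal ?_ isClosed_cthickening
  refine (support_convolution_subset _).trans ?_
  rintro _ ⟨y, hy, z, hz, rfl⟩
  rw [b.support_normed_eq] at hy
  refine Metric.mem_cthickening_of_dist_le _ z _ _ (subset_tsupport _ hz) ?_
  simpa using (mem_ball.1 hy).le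

theorem vmoll_compact {d : ℕ} (b : ContDiffBump (0 : Rd d)) {φ : Rd d → Rd d}
    (hc : HasCompactSupport φ) : HasCompactSupport (vmoll b φ) :=
  HasCompactSupport.convolution _ b.hasCompactSupport_normed hc

theorem vmoll_vdiv {d : ℕ} (b : ContDiffBump (0 : Rd d)) {φ : Rd d → Rd d}
    (hφ : ContDiff ℝ 1 φ) (hc : HasCompactSupport φ) (x : Rd d) :
    vdiv (vmoll b φ) x = ∫ t, b.normed volume (x - t) * vdiv φ t := by
  have hb : Integrable (b.normed volume) :=
    b.continuous_normed.integrable_of_hasCompactSupport b.hasCompactSupport_normed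
  have h := hc.hasFDerivAt_convolution_right (ContinuousLinearMap.lsmul ℝ ℝ) 
    (f := b.normed volume) (μ := volume) hb.locallyIntegrable hφ x
  have hd := hφ.continuous_fderiv one_ne_zero
  have hbc := b.continuous_normed (μ := volume)
  unfold vdiv
  have h' : fderiv ℝ (vmoll b φ) x = ∫ t, b.normed volume (x - t) • fderiv ℝ φ t := by
    have h2 : HasFDerivAt (vmoll b φ) _ x := h
    rw [h2.fderiv, convolution_eq_swap]
    refine integral_congr_ae (Eventually.of_forall fun t => ?_)
    ext v : 1
    simp [ContinuousLinearMap.precompR_apply]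
  rw [h']
  have hi : Integrable (fun t => b.normed volume (x - t) • fderiv ℝ φ t) := by
    refine Continuous.integrable_of_hasCompactSupport (by fun_prop) ?_
    refine (hc.fderiv (𝕜 := ℝ)).mono fun t ht h0 => ht ?_
    simp only [h0]
    ext v : 1
    simp
  simp_rw [Finset.mul_sum]
  rw [integral_finsetSum]
  · refine Finset.sum_congr rfl fun i _ => ?_
    rw [ContinuousLinearMap.integral_apply hi]
    have := (EuclideanSpace.proj i : Rd d →L[ℝ] ℝ).integral_comp_comm
      (hi.apply_continuousLinearMap (EuclideanSpace.single i (1:ℝ)))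
    exact this.symm
  · intro i _
    have := (EuclideanSpace.proj i : Rd d →L[ℝ] ℝ).integrable_comp
      (hi.apply_continuousLinearMap (EuclideanSpace.single i (1:ℝ)))
    exact this

/-- the total variation of the mollified function is bounded by the perimeter -/
theorem moll_bound {d : ℕ} (b : ContDiffBump (0 : Rd d)) {F U : Set (Rd d)} (hF : MeasurableSet F)
    (hfin : perimOpen F U ≠ ∞) {η : Rd d → ℝ} (hη : ContDiff ℝ 1 η) (hc : HasCompactSupport η)
    (h0 : ∀ x, 0 ≤ η x) (h1 : ∀ x, η x ≤ 1) (hU : Metric.cthickening b.rOut (tsupport η) ⊆ U) :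
    ∫ x, η x * ‖fderiv ℝ (moll b F) x‖ ≤ (perimOpen F U).toReal := by
  have hu := moll_contDiff b hF
  have hu1 : ContDiff ℝ 1 (moll b F) := hu.of_le (by norm_num)
  have hηc := hη.continuous
  have hdu := hu1.continuous_fderiv one_ne_zero
  set g : Rd d → Rd d := fun x => (InnerProductSpace.toDual ℝ (Rd d)).symm (fderiv ℝ (moll b F) x)
    with hg
  have hgn : ∀ x, ‖g x‖ = ‖fderiv ℝ (moll b F) x‖ := fun x => by simp [hg]
  have hgi : ∀ x v, fderiv ℝ (moll b F) x v = inner ℝ (g x) v := fun x v => by simp [hg]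
  have hgC : ContDiff ℝ 1 g := by
    refine (InnerProductSpace.toDual ℝ (Rd d)).symm.contDiff.comp ?_
    exact hu.fderiv_right (by norm_num)
  have step : ∀ s : ℝ, 0 < s → ∫ x, η x * ‖fderiv ℝ (moll b F) x‖ ≤
      (perimOpen F U).toReal + s * ∫ x, η x := by
    intro s hs
    have hpos : ∀ x, 0 < ‖g x‖ ^ 2 + s ^ 2 := fun x => by positivity
    set N : Rd d → ℝ := fun x => Real.sqrt (‖g x‖ ^ 2 + s ^ 2) with hN
    have hNpos : ∀ x, 0 < N x := fun x => Real.sqrt_pos.2 (hpos x)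
    have hNC : ContDiff ℝ 1 N := ((hgC.norm_sq ℝ).add contDiff_const).sqrt fun x => (hpos x).ne'
    have hNge : ∀ x, ‖g x‖ ≤ N x := fun x => Real.le_sqrt_of_sq_le (by nlinarith [sq_nonneg s])
    have hNle : ∀ x, N x ≤ ‖g x‖ + s := fun x => 
      Real.sqrt_le_iff.2 ⟨by positivity, by nlinarith [norm_nonneg (g x)]⟩
    set φ : Rd d → Rd d := fun x => η x • (-((N x)⁻¹ • g x)) with hφd
    have hφ : ContDiff ℝ 1 φ := hη.smul ((hNC.inv fun x => (hNpos x).ne').smul hgC).neg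
    have hφc : HasCompactSupport φ := hc.smul_right
    have hφn : ∀ x, ‖φ x‖ ≤ 1 := by
      intro x
      simp only [hφd, norm_smul, norm_neg, norm_inv, Real.norm_of_nonneg (h0 x),
        Real.norm_of_nonneg (hNpos x).le]
      have : (N x)⁻¹ * ‖g x‖ ≤ 1 := by
        rw [inv_mul_le_iff₀ (hNpos x), mul_one]; exact hNge x
      exact mul_le_one₀ (h1 x) (by have := (hNpos x).le; positivity) this
    have hts : tsupport φ ⊆ tsupport η := closure_mono fun x hx => by
      intro h; apply hx; simp [hφd, h]
    have k1 := perimOpen_ge hfin (vmoll_contDiff b hφ) (vmoll_compact b hφc)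
      ((vmoll_tsupport b).trans ((cthickening_subset_of_subset _ hts).trans hU)) (vmoll_norm b hφn)
    simp_rw [vmoll_vdiv b hφ hφc] at k1
    rw [← moll_fubini b hF (vdiv_continuous hφ) (vdiv_hasCompactSupport hφc),
      ibp hu1 hφ hφc, ← integral_neg] at k1
    have e : ∀ x, -(fderiv ℝ (moll b F) x (φ x)) = η x * ((N x)⁻¹ * ‖g x‖ ^ 2) := by
      intro x
      rw [hgi, hφd]
      simp only [inner_smul_right, inner_neg_right, real_inner_self_eq_norm_sq]
      ring
    simp_rw [e] at k1
    have hgc := hgC.continuous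
    have hNc := hNC.continuous
    have i1 : Integrable (fun x => η x * ((N x)⁻¹ * ‖g x‖ ^ 2)) := by
      refine Continuous.integrable_of_hasCompactSupport ?_ hc.mul_right
      exact hηc.mul ((hNc.inv₀ fun x => (hNpos x).ne').mul (hgc.norm.pow 2))
    have i2 : Integrable (fun x => s * η x) :=
      (hηc.integrable_of_hasCompactSupport hc).const_mul s
    have i3 : Integrable (fun x => η x * ‖fderiv ℝ (moll b F) x‖) :=
      Continuous.integrable_of_hasCompactSupport (by fun_prop) hc.mul_right
    rw [← integral_const_mul]
    refine le_trans ?_ (add_le_add_left k1 _)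
    rw [← integral_add i1 i2]
    refine integral_mono i3 (i1.add i2) fun x => ?_
    simp only []
    rw [← hgn]
    have : ‖g x‖ ≤ (N x)⁻¹ * ‖g x‖ ^ 2 + s := by
      rw [← sub_le_iff_le_add, le_inv_mul_iff₀ (hNpos x)]
      have h3 := hNle x
      have h4 := hNge x
      have h5 := norm_nonneg (g x)
      have h6 := hNpos x
      by_cases hsg : ‖g x‖ ≤ s
      · nlinarith
      · push Not at hsg
        nlinarith
    nlinarith [h0 x]
  have hI : 0 ≤ ∫ x, η x := integral_nonneg h0
  refine le_of_forall_pos_le_add fun ε hε => ?_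
  refine (step (ε / ((∫ x, η x) + 1)) (by positivity)).trans ?_
  gcongr
  rw [div_mul_eq_mul_div, div_le_iff₀ (by positivity)]
  nlinarith

/-- a sequence of bumps -/
def bseq (d : ℕ) (n : ℕ) : ContDiffBump (0 : Rd d) where
  rIn := 1 / (2 * ((n : ℝ) + 1))
  rOut := 1 / ((n : ℝ) + 1)
  rIn_pos := by positivity
  rIn_lt_rOut := by
    apply one_div_lt_one_div_of_lt <;> nlinarith [(Nat.cast_nonneg n : (0:ℝ) ≤ n)]

theorem bseq_rOut (d : ℕ) : Tendsto (fun n => (bseq d n).rOut) atTop (𝓝 0) :=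
  tendsto_one_div_add_atTop_nhds_zero_nat

theorem bseq_ae {d : ℕ} {F : Set (Rd d)} (hF : MeasurableSet F) :
    ∀ᵐ x, Tendsto (fun n => moll (bseq d n) F x) atTop (𝓝 (F.indicator (fun _ => (1:ℝ)) x)) := by
  refine ContDiffBump.ae_convolution_tendsto_right_of_locallyIntegrable (K := 2) (bseq_rOut d)
    (Eventually.of_forall fun n => ?_) (ind_li hF)
  simp only [bseq]
  field_simp
  exact le_rfl

theorem bseq_lim {d : ℕ} {F : Set (Rd d)} (hF : MeasurableSet F) {h : Rd d → ℝ}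
    (hh : Integrable h) (m : ℕ) (hm : m ≠ 0) :
    Tendsto (fun n => ∫ x, (moll (bseq d n) F x) ^ m * h x) atTop (𝓝 (∫ x in F, h x)) := by
  rw [← integral_indicator hF]
  refine tendsto_integral_of_dominated_convergence (fun x => ‖h x‖) (fun n => ?_) hh.norm
    (fun n => Eventually.of_forall fun x => ?_) ?_
  · exact ((moll_contDiff (bseq d n) hF).continuous.pow m).aestronglyMeasurable.mul hh.1
  · rw [norm_mul]
    refine mul_le_of_le_one_left (norm_nonneg _) ?_
    rw [norm_pow, Real.norm_of_nonneg (moll_nonneg _ _ _)]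
    exact pow_le_one₀ (moll_nonneg _ _ _) (moll_le_one _ hF _)
  · filter_upwards [bseq_ae hF] with x hx
    have := (hx.pow m).mul_const (h x)
    convert this using 2
    by_cases hxF : x ∈ F <;> simp [hxF, hm]

theorem alg_ineq {d N : ℕ} (w : Fin N → Rd d) (hw : ∀ i j, ‖w i - w j‖ ≤ 1)
    (u : Fin N → ℝ) (T : Fin N → (Rd d →L[ℝ] ℝ)) (hu : ∀ k, 0 ≤ u k) (hs : ∑ k, u k = 1)
    (hT : ∑ k, T k = 0) : -∑ k, T k (w k) ≤ ∑ k, (1 - u k) * ‖T k‖ := by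
  have e1 : ∑ k, T k (w k) = ∑ k, ∑ j, u j * T k (w k - w j) := by
    simp_rw [map_sub, mul_sub, Finset.sum_sub_distrib, ← Finset.sum_mul, hs, one_mul]
    rw [Finset.sum_comm]
    simp_rw [← Finset.mul_sum]
    have : ∀ j, ∑ k, T k (w j) = 0 := fun j => by
      have := congrArg (fun L : Rd d →L[ℝ] ℝ => L (w j)) hT
      simpa using this
    simp [this]
  rw [e1, ← Finset.sum_neg_distrib]
  refine Finset.sum_le_sum fun k _ => ?_
  have e2 : 1 - u k = ∑ j ∈ Finset.univ.erase k, u j := by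
    rw [← hs, ← Finset.add_sum_erase _ _ (Finset.mem_univ k)]; ring
  rw [← Finset.add_sum_erase _ _ (Finset.mem_univ k), e2, Finset.sum_mul, sub_self, map_zero,
    mul_zero, zero_add, ← Finset.sum_neg_distrib]
  refine Finset.sum_le_sum fun j _ => ?_
  rw [← mul_neg]
  refine mul_le_mul_of_nonneg_left ?_ (hu j)
  calc -(T k (w k - w j)) ≤ ‖T k (w k - w j)‖ := neg_le_abs _
    _ ≤ ‖T k‖ * ‖w k - w j‖ := (T k).le_opNorm _
    _ ≤ ‖T k‖ := mul_le_of_le_one_right (norm_nonneg _) (hw k j)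

theorem F_side_n {d N : ℕ} (w : Fin N → Rd d) (hw : ∀ i j, ‖w i - w j‖ ≤ 1)
    {F : Fin N → Set (Rd d)} (hF : IsPartition Set.univ F) {U : Set (Rd d)}
    (hfin : ∀ k, perimOpen (F k) U ≠ ∞) {η : Rd d → ℝ} (hη : ContDiff ℝ 1 η)
    (hc : HasCompactSupport η)
    (h0 : ∀ x, 0 ≤ η x) (h1 : ∀ x, η x ≤ 1) (ψ : Fin N → Rd d → Rd d)
    (hψ : ∀ k, ContDiff ℝ 1 (ψ k)) (hψc : ∀ k, HasCompactSupport (ψ k))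
    (hψη : ∀ k x, ‖ψ k x‖ ≤ η x) (b : ContDiffBump (0 : Rd d))
    (hU : Metric.cthickening b.rOut (tsupport η) ⊆ U) :
    2 * ∑ k, ∫ x, moll b (F k) x * fderiv ℝ η x (w k) ≤
      ∑ k, (2 * (perimOpen (F k) U).toReal - ∫ x, (moll b (F k) x) ^ 2 * vdiv (ψ k) x) := by
  have hu : ∀ k, ContDiff ℝ 1 (moll b (F k)) := fun k =>
    (moll_contDiff b (hF.1 k)).of_le (by norm_num)
  have huc := fun k => (hu k).continuous
  have hdu := fun k => (hu k).continuous_fderiv one_ne_zero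
  have hηc := hη.continuous
  have a1 : ∀ k, ∫ x, moll b (F k) x * fderiv ℝ η x (w k) =
      - ∫ x, η x * fderiv ℝ (moll b (F k)) x (w k) := by
    intro k
    have := ibp (φ := fun y => η y • w k) (hu k) (hη.smul contDiff_const : ContDiff ℝ 1 (fun y => η y • w k)) hc.smul_right
    simp_rw [vdiv_smul_const hη, map_smul, smul_eq_mul] at this
    exact this
  have i1 : ∀ k, Integrable (fun x => η x * fderiv ℝ (moll b (F k)) x (w k)) := fun k =>
    Continuous.integrable_of_hasCompactSupport
      (hηc.mul ((hdu k).clm_apply continuous_const)) hc.mul_right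
  have i2 : ∀ k, Integrable (fun x => η x * ‖fderiv ℝ (moll b (F k)) x‖) := fun k =>
    Continuous.integrable_of_hasCompactSupport (hηc.mul (hdu k).norm) hc.mul_right
  have i3 : ∀ k, Integrable (fun x => η x * (2 * moll b (F k) x * ‖fderiv ℝ (moll b (F k)) x‖)) :=
    fun k => Continuous.integrable_of_hasCompactSupport
      (hηc.mul ((continuous_const.mul (huc k)).mul (hdu k).norm)) hc.mul_right
  have a2 : ∀ k, ∫ x, (moll b (F k) x) ^ 2 * vdiv (ψ k) x ≤
      ∫ x, η x * (2 * moll b (F k) x * ‖fderiv ℝ (moll b (F k)) x‖) := by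
    intro k
    have hsq : ContDiff ℝ 1 (fun x => (moll b (F k) x) ^ 2) := (hu k).pow 2
    rw [ibp hsq (hψ k) (hψc k), ← integral_neg]
    have e : ∀ x, -(fderiv ℝ (fun x => (moll b (F k) x) ^ 2) x (ψ k x)) =
        -(2 * moll b (F k) x * fderiv ℝ (moll b (F k)) x (ψ k x)) := by
      intro x
      have := ((hu k).differentiable one_ne_zero x).hasFDerivAt.pow 2
      have h2 : HasFDerivAt (fun x => (moll b (F k) x) ^ 2) _ x := this
      rw [h2.fderiv]
      simp
    simp_rw [e]
    refine integral_mono ?_ (i3 k) fun x => ?_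
    · refine Continuous.integrable_of_hasCompactSupport
        ((continuous_const.mul (huc k)).mul ((hdu k).clm_apply (hψ k).continuous)).neg ?_
      refine (hψc k).mono fun x hx h => hx ?_
      simp [h]
    · have hm := moll_nonneg b (F k) x
      have : -(fderiv ℝ (moll b (F k)) x (ψ k x)) ≤ ‖fderiv ℝ (moll b (F k)) x‖ * η x :=
        (neg_le_abs _).trans (((fderiv ℝ (moll b (F k)) x).le_opNorm _).trans
          (mul_le_mul_of_nonneg_left (hψη k x) (norm_nonneg _)))
      simp only []
      nlinarith
  have i4 : ∀ k, Integrable (fun x => η x * ‖fderiv ℝ (moll b (F k)) x‖ -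
        1 / 2 * (η x * (2 * moll b (F k) x * ‖fderiv ℝ (moll b (F k)) x‖))) := fun k =>
    (i2 k).sub ((i3 k).const_mul _)
  have a3 : ∑ k, ∫ x, moll b (F k) x * fderiv ℝ η x (w k) ≤
      ∑ k, ∫ x, (η x * ‖fderiv ℝ (moll b (F k)) x‖ -
        1 / 2 * (η x * (2 * moll b (F k) x * ‖fderiv ℝ (moll b (F k)) x‖))) := by
    simp_rw [a1]
    rw [Finset.sum_neg_distrib, ← integral_finsetSum _ fun k _ => i1 k,
      ← integral_finsetSum _ fun k _ => i4 k, ← integral_neg]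
    refine integral_mono (integrable_finsetSum _ fun k _ => i1 k).neg
      (integrable_finsetSum _ fun k _ => i4 k) fun x => ?_
    have hs0 : (fun y => ∑ k, moll b (F k) y) = fun _ => (1:ℝ) :=
      funext fun y => moll_sum b hF y
    have hT : ∑ k, fderiv ℝ (moll b (F k)) x = 0 := by
      rw [← fderiv_fun_sum fun k _ => (hu k).differentiable one_ne_zero x, hs0]
      simp
    have := alg_ineq w hw (fun k => moll b (F k) x) (fun k => fderiv ℝ (moll b (F k)) x)
      (fun k => moll_nonneg _ _ _) (moll_sum b hF x) hT
    have h3 := mul_le_mul_of_nonneg_left this (h0 x)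
    simp only [] at h3 ⊢
    rw [mul_neg, Finset.mul_sum, Finset.mul_sum] at h3
    refine h3.trans (le_of_eq (Finset.sum_congr rfl fun k _ => ?_))
    ring
  refine (mul_le_mul_of_nonneg_left a3 zero_le_two).trans ?_
  rw [Finset.mul_sum]
  refine Finset.sum_le_sum fun k _ => ?_
  rw [integral_sub (i2 k) ((i3 k).const_mul _), integral_const_mul]
  have b1 := moll_bound b (hF.1 k) (hfin k) hη hc h0 h1 hU
  have b2 := a2 k
  linarith

theorem F_side {d N : ℕ} (w : Fin N → Rd d) (hw : ∀ i j, ‖w i - w j‖ ≤ 1)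
    {F : Fin N → Set (Rd d)} (hF : IsPartition Set.univ F) {U : Set (Rd d)} (hUo : IsOpen U)
    (hfin : ∀ k, perimOpen (F k) U ≠ ∞) {η : Rd d → ℝ} (hη : ContDiff ℝ 1 η)
    (hc : HasCompactSupport η) (hts : tsupport η ⊆ U)
    (h0 : ∀ x, 0 ≤ η x) (h1 : ∀ x, η x ≤ 1) (ψ : Fin N → Rd d → Rd d)
    (hψ : ∀ k, ContDiff ℝ 1 (ψ k)) (hψc : ∀ k, HasCompactSupport (ψ k))
    (hψη : ∀ k x, ‖ψ k x‖ ≤ η x) :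
    2 * ∑ k, ∫ x in F k, fderiv ℝ η x (w k) ≤
      ∑ k, (2 * (perimOpen (F k) U).toReal - ∫ x in F k, vdiv (ψ k) x) := by
  obtain ⟨δ, hδ, hδU⟩ := hc.isCompact.exists_cthickening_subset_open hUo hts
  have hdη := hη.continuous_fderiv one_ne_zero
  have ev : ∀ᶠ n in atTop, (bseq d n).rOut < δ := (bseq_rOut d).eventually_lt_const hδ
  have hi : ∀ k, Integrable (fun x => fderiv ℝ η x (w k)) := fun k =>
    Continuous.integrable_of_hasCompactSupport (by fun_prop) (hc.fderiv_apply (𝕜 := ℝ) _)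
  have l1 : Tendsto (fun n => 2 * ∑ k, ∫ x, moll (bseq d n) (F k) x * fderiv ℝ η x (w k)) atTop
      (𝓝 (2 * ∑ k, ∫ x in F k, fderiv ℝ η x (w k))) := by
    refine (tendsto_finsetSum _ fun k _ => ?_).const_mul 2
    simpa using bseq_lim (hF.1 k) (hi k) 1 one_ne_zero
  have l2 : Tendsto (fun n => ∑ k, (2 * (perimOpen (F k) U).toReal -
      ∫ x, (moll (bseq d n) (F k) x) ^ 2 * vdiv (ψ k) x)) atTop
      (𝓝 (∑ k, (2 * (perimOpen (F k) U).toReal - ∫ x in F k, vdiv (ψ k) x))) :=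
    tendsto_finsetSum _ fun k _ =>
      (bseq_lim (hF.1 k) (vdiv_integrable (hψ k) (hψc k)) 2 two_ne_zero).const_sub _
  refine le_of_tendsto_of_tendsto l1 l2 ?_
  filter_upwards [ev] with n hn
  exact F_side_n w hw hF hfin hη hc h0 h1 ψ hψ hψc hψη _ ((cthickening_mono hn.le _).trans hδU)

theorem cutoff {d : ℕ} {K U : Set (Rd d)} (hK : IsCompact K) (hU : IsOpen U) (hKU : K ⊆ U) :
    ∃ η : Rd d → ℝ, ContDiff ℝ 1 η ∧ HasCompactSupport η ∧ tsupport η ⊆ U ∧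
      (∀ x, 0 ≤ η x) ∧ (∀ x, η x ≤ 1) ∧ ∀ x ∈ K, η x = 1 := by
  obtain ⟨L, hL, hKL, hLU⟩ := exists_compact_between hK hU hKU
  obtain ⟨f, hf0, hf1, hf⟩ := exists_contMDiffMap_zero_one_of_isClosed (n := 1)
    (modelWithCornersSelf ℝ (Rd d))
    (isOpen_interior (s := L)).isClosed_compl hK.isClosed
    (disjoint_left.2 fun x hx hx2 => hx (hKL hx2))
  have hts : tsupport f ⊆ L := closure_minimal (fun x hx => by
    by_contra h
    exact hx (hf0 fun h2 => h (interior_subset h2))) hL.isClosed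
  refine ⟨f, f.contMDiff.contDiff, HasCompactSupport.of_support_subset_isCompact hL
    ((subset_tsupport _).trans hts), hts.trans hLU, fun x => (hf x).1, fun x => (hf x).2, hf1⟩

/-- planar cross product -/
def cr (a x : Rd 2) : ℝ := a 0 * x 1 - a 1 * x 0

theorem cr_le (a x : Rd 2) (ha : a 0 ^ 2 + a 1 ^ 2 = 1) : |cr a x| ≤ ‖x‖ := by
  rw [EuclideanSpace.norm_eq, Fin.sum_univ_two]
  apply Real.abs_le_sqrt
  simp only [Real.norm_eq_abs, sq_abs, cr]
  nlinarith [sq_nonneg (a 0 * x 0 + a 1 * x 1)]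

theorem cr_continuous (a : Rd 2) : Continuous (cr a) := by
  unfold cr; fun_prop

theorem cr_continuous' (a : Rd 2) : Continuous (fun x => cr x a) := by
  unfold cr; fun_prop

theorem vol2 : MeasurePreserving (fun p : ℝ × ℝ => (!₂[p.1, p.2] : Rd 2)) := by
  have h1 := (volume_preserving_finTwoArrow ℝ).symm
  have h2 := PiLp.volume_preserving_toLp (Fin 2)
  have h3 := h2.comp h1
  exact h3

theorem vol2_emb : MeasurableEmbedding (fun p : ℝ × ℝ => (!₂[p.1, p.2] : Rd 2)) := by
  have : Continuous (fun p : ℝ × ℝ => (!₂[p.1, p.2] : Rd 2)) := by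
    refine (PiLp.continuous_toLp 2 _).comp ?_
    refine continuous_pi fun i => ?_
    fin_cases i
    · exact continuous_fst
    · exact continuous_snd
  refine this.measurableEmbedding ?_
  intro p q h
  have e0 := congrArg (fun v : Rd 2 => v 0) h
  have e1 := congrArg (fun v : Rd 2 => v 1) h
  simp at e0 e1
  exact Prod.ext e0 e1

theorem sector_integral (a b : Rd 2) (hD : 0 < cr a b) (h : Rd 2 → ℝ) :
    ∫ x in {x | 0 < cr a x ∧ 0 < cr x b}, h x =
      ∫ p in (Ioi (0:ℝ)) ×ˢ (Ioi (0:ℝ)), cr a b * h (p.1 • a + p.2 • b) := by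
  rw [← vol2.setIntegral_preimage_emb vol2_emb]
  set M : (ℝ × ℝ) →L[ℝ] (ℝ × ℝ) := LinearMap.toContinuousLinearMap
    (Matrix.toLin (Module.Basis.finTwoProd ℝ) (Module.Basis.finTwoProd ℝ)
      !![a 0, b 0; a 1, b 1]) with hM
  have hMp : ∀ p, M p = (p.1 * a 0 + p.2 * b 0, p.1 * a 1 + p.2 * b 1) := by
    intro p
    simp [hM, Matrix.toLin_finTwoProd_apply, mul_comm]
  have hdet : M.det = cr a b := by
    rw [hM, ContinuousLinearMap.det, LinearMap.coe_toContinuousLinearMap, LinearMap.det_toLin,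
      Matrix.det_fin_two_of, cr]
    ring
  have hset : (fun p : ℝ × ℝ => (!₂[p.1, p.2] : Rd 2)) ⁻¹' {x | 0 < cr a x ∧ 0 < cr x b} =
      M '' ((Ioi (0:ℝ)) ×ˢ (Ioi (0:ℝ))) := by
    ext p
    simp only [mem_preimage, mem_ofPred_eq, mem_image, mem_prod, mem_Ioi, hMp, Prod.exists]
    constructor
    · rintro ⟨h1, h2⟩
      refine ⟨cr !₂[p.1, p.2] b / cr a b, cr a !₂[p.1, p.2] / cr a b,
        ⟨div_pos h2 hD, div_pos h1 hD⟩, ?_⟩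
      have hD' := hD.ne'
      ext
      · simp only []
        field_simp
        simp [cr]; ring
      · simp only []
        field_simp
        simp [cr]; ring
    · rintro ⟨s, t, ⟨hs, ht⟩, rfl⟩
      have e1 : cr a !₂[s * a 0 + t * b 0, s * a 1 + t * b 1] = t * cr a b := by
        simp [cr]; ring
      have e2 : cr !₂[s * a 0 + t * b 0, s * a 1 + t * b 1] b = s * cr a b := by
        simp [cr]; ring
      simp only [e1, e2]
      exact ⟨by positivity, by positivity⟩
  have hinj : Function.Injective M := by
    intro p q hpq
    rw [hMp, hMp, Prod.mk.injEq] at hpq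
    obtain ⟨h1, h2⟩ := hpq
    have hD' := hD.ne'
    unfold cr at hD'
    ext
    · have : (p.1 - q.1) * (a 0 * b 1 - a 1 * b 0) = 0 := by linear_combination b 1 * h1 - b 0 * h2
      have := (mul_eq_zero.1 this).resolve_right hD'
      linarith
    · have : (p.2 - q.2) * (a 0 * b 1 - a 1 * b 0) = 0 := by linear_combination a 0 * h2 - a 1 * h1
      have := (mul_eq_zero.1 this).resolve_right hD'
      linarith
  rw [hset, integral_image_eq_integral_abs_det_fderiv_smul volume
    (measurableSet_Ioi.prod measurableSet_Ioi) (fun x _ => M.hasFDerivAt.hasFDerivWithinAt)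
    hinj.injOn]
  refine integral_congr_ae (Eventually.of_forall fun p => ?_)
  simp only [hdet, abs_of_pos hD, smul_eq_mul, hMp]
  congr 2
  ext i
  fin_cases i <;> simp

theorem line_emb {a : Rd 2} (ha : a ≠ 0) (c : Rd 2) :
    Topology.IsClosedEmbedding (fun s : ℝ => s • a + c) :=
  (Homeomorph.addRight c).isClosedEmbedding.comp (isClosedEmbedding_smul_left ha)

theorem line_deriv {a b c : Rd 2} (ha : a ≠ 0) {φ : Rd 2 → Rd 2} (hφ : ContDiff ℝ 1 φ)
    (hc : HasCompactSupport φ) :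
    ∫ s in Ioi (0:ℝ), cr (fderiv ℝ φ (s • a + c) a) b = - cr (φ c) b := by
  have hdiff : ContDiff ℝ 1 (fun s : ℝ => cr (φ (s • a + c)) b) := by
    unfold cr
    have : ContDiff ℝ 1 (fun s : ℝ => φ (s • a + c)) := hφ.comp (by fun_prop)
    have h0 : ContDiff ℝ 1 (fun s : ℝ => φ (s • a + c) 0) := by fun_prop
    have h1 : ContDiff ℝ 1 (fun s : ℝ => φ (s • a + c) 1) := by fun_prop
    exact (h0.mul contDiff_const).sub (h1.mul contDiff_const)
  have hcs : HasCompactSupport (fun s : ℝ => cr (φ (s • a + c)) b) := by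
    have := hc.comp_isClosedEmbedding (line_emb ha c)
    exact this.comp_left (g := fun v => cr v b) (by simp [cr])
  have key := hcs.integral_Ioi_deriv_eq hdiff 0
  simp only [zero_smul, zero_add] at key
  rw [← key]
  refine integral_congr_ae (Eventually.of_forall fun s => ?_)
  have h1 : HasDerivAt (fun s : ℝ => s • a + c) a s := by
    simpa using ((hasDerivAt_id s).smul_const a).add_const c
  have h2 : HasDerivAt (fun s : ℝ => φ (s • a + c)) (fderiv ℝ φ (s • a + c) a) s :=
    ((hφ.differentiable one_ne_zero) (s • a + c)).hasFDerivAt.comp_hasDerivAt s h1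
  have h3 : ∀ i, HasDerivAt (fun s : ℝ => φ (s • a + c) i) (fderiv ℝ φ (s • a + c) a i) s :=
    fun i => (EuclideanSpace.proj i : Rd 2 →L[ℝ] ℝ).hasFDerivAt.comp_hasDerivAt s h2
  have h4 : HasDerivAt (fun s : ℝ => cr (φ (s • a + c)) b) (cr (fderiv ℝ φ (s • a + c) a) b) s :=
    ((h3 0).mul_const (b 1)).sub ((h3 1).mul_const (b 0))
  exact h4.deriv.symm

theorem cr_swap (a b : Rd 2) : cr a b = - cr b a := by unfold cr; ring

theorem cr_trace (A : Rd 2 →L[ℝ] Rd 2) (a b : Rd 2) :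
    cr a b * ∑ i : Fin 2, A (EuclideanSpace.single i (1 : ℝ)) i = cr (A a) b - cr (A b) a := by
  have e : ∀ v : Rd 2, A v = v 0 • A (EuclideanSpace.single 0 (1:ℝ)) +
      v 1 • A (EuclideanSpace.single 1 (1:ℝ)) := by
    intro v
    rw [← map_smul, ← map_smul, ← map_add]
    congr 1
    ext i
    fin_cases i <;> simp
  rw [e a, e b, Fin.sum_univ_two]
  simp only [cr, PiLp.add_apply, PiLp.smul_apply, smul_eq_mul]
  ring

/-- Gauss-Green formula on a sector -/
theorem gauss_green (a b : Rd 2) (hD : 0 < cr a b) {φ : Rd 2 → Rd 2} (hφ : ContDiff ℝ 1 φ)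
    (hc : HasCompactSupport φ) :
    ∫ x in {x | 0 < cr a x ∧ 0 < cr x b}, vdiv φ x =
      (∫ t in Ioi (0:ℝ), cr b (φ (t • b))) - ∫ s in Ioi (0:ℝ), cr a (φ (s • a)) := by
  have ha : a ≠ 0 := by rintro rfl; simp [cr] at hD
  have hb : b ≠ 0 := by rintro rfl; simp [cr] at hD
  have hdφ := hφ.continuous_fderiv one_ne_zero
  rw [sector_integral a b hD]
  have e : ∀ p : ℝ × ℝ, cr a b * vdiv φ (p.1 • a + p.2 • b) =
      cr (fderiv ℝ φ (p.1 • a + p.2 • b) a) b - cr (fderiv ℝ φ (p.1 • a + p.2 • b) b) a :=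
    fun p => cr_trace _ a b
  simp_rw [e]
  have hemb : Topology.IsClosedEmbedding (fun p : ℝ × ℝ => p.1 • a + p.2 • b) := by
    let L : (ℝ × ℝ) →ₗ[ℝ] Rd 2 :=
      (LinearMap.fst ℝ ℝ ℝ).smulRight a + (LinearMap.snd ℝ ℝ ℝ).smulRight b
    have hL : LinearMap.ker L = ⊥ := by
      rw [LinearMap.ker_eq_bot']
      intro p hp
      have hp' : p.1 • a + p.2 • b = 0 := hp
      have h0 := congrArg (fun v : Rd 2 => v 0) hp'
      have h1 := congrArg (fun v : Rd 2 => v 1) hp'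
      simp at h0 h1
      have hD' := hD.ne'
      unfold cr at hD'
      ext
      · have : p.1 * (a 0 * b 1 - a 1 * b 0) = 0 := by linear_combination b 1 * h0 - b 0 * h1
        exact (mul_eq_zero.1 this).resolve_right hD'
      · have : p.2 * (a 0 * b 1 - a 1 * b 0) = 0 := by linear_combination a 0 * h1 - a 1 * h0
        exact (mul_eq_zero.1 this).resolve_right hD'
    exact LinearMap.isClosedEmbedding_of_injective hL
  have hint : ∀ v c : Rd 2,
      Integrable (fun p : ℝ × ℝ => cr (fderiv ℝ φ (p.1 • a + p.2 • b) v) c) := by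
    intro v c
    refine Continuous.integrable_of_hasCompactSupport ?_ ?_
    · exact (cr_continuous' c).comp ((hdφ.comp hemb.continuous).clm_apply continuous_const)
    · have := (hc.fderiv (𝕜 := ℝ)).comp_isClosedEmbedding hemb
      exact this.comp_left (g := fun A : Rd 2 →L[ℝ] Rd 2 => cr (A v) c) (by simp [cr])
  rw [integral_sub (hint a b).integrableOn (hint b a).integrableOn]
  rw [Measure.volume_eq_prod]
  rw [setIntegral_prod _ (hint b a).integrableOn]
  rw [← setIntegral_prod_swap, setIntegral_prod (fun z : ℝ × ℝ =>
    cr (fderiv ℝ φ (z.swap.1 • a + z.swap.2 • b) a) b) (hint a b).swap.integrableOn]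
  simp only [Prod.swap_prod_mk, Prod.fst_swap, Prod.snd_swap]
  have e1 : ∀ t : ℝ, ∫ s in Ioi (0:ℝ), cr (fderiv ℝ φ (s • a + t • b) a) b =
      cr b (φ (t • b)) := fun t => by
    rw [line_deriv ha hφ hc, ← cr_swap]
  have e2 : ∀ s : ℝ, ∫ t in Ioi (0:ℝ), cr (fderiv ℝ φ (s • a + t • b) b) a =
      cr a (φ (s • a)) := fun s => by
    simp_rw [add_comm (s • a)]
    rw [line_deriv hb hφ hc, ← cr_swap]
  simp_rw [e1, e2]

/-- the three directions -/
def dir (k : Fin 3) : Rd 2 :=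
  ![!₂[1, 0], !₂[-1/2, Real.sqrt 3 / 2], !₂[-1/2, -(Real.sqrt 3 / 2)]] k

/-- unit vector with given angle -/
def dA (θ : ℝ) : Rd 2 := !₂[Real.cos θ, Real.sin θ]

theorem cos_c : Real.cos (2 * Real.pi / 3) = -1/2 := by
  rw [show 2 * Real.pi / 3 = Real.pi - Real.pi / 3 by ring, Real.cos_pi_sub, Real.cos_pi_div_three]
  ring

theorem sin_c : Real.sin (2 * Real.pi / 3) = Real.sqrt 3 / 2 := by
  rw [show 2 * Real.pi / 3 = Real.pi - Real.pi / 3 by ring, Real.sin_pi_sub, Real.sin_pi_div_three]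

theorem sqrt3 : Real.sqrt 3 * Real.sqrt 3 = 3 := Real.mul_self_sqrt (by norm_num)

theorem dA_k (k : Fin 3) : dA (((k : ℕ) : ℝ) * (2 * Real.pi / 3)) = dir k := by
  fin_cases k
  · simp [dA, dir]
  · simp [dA, dir, cos_c, sin_c]
  · have h1 : Real.cos (2 * (2 * Real.pi / 3)) = -1/2 := by
      rw [Real.cos_two_mul, cos_c]; norm_num
    have h2 : Real.sin (2 * (2 * Real.pi / 3)) = -(Real.sqrt 3 / 2) := by
      rw [Real.sin_two_mul, cos_c, sin_c]; ring
    simp [dA, dir, h1, h2]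

theorem dA_k1 (k : Fin 3) : dA ((((k : ℕ) : ℝ) + 1) * (2 * Real.pi / 3)) = dir (k + 1) := by
  by_cases hk : k = 2
  · subst hk
    have : (((2 : Fin 3) : ℕ) : ℝ) = 2 := by norm_num
    rw [this, show ((2:ℝ) + 1) * (2 * Real.pi / 3) = 2 * Real.pi by ring]
    simp [dA, dir]
  · rw [← dA_k]
    have : ((k + 1 : Fin 3) : ℕ) = (k : ℕ) + 1 := by revert hk; revert k; decide
    rw [this]; push_cast; rfl

theorem tj_eq (k : Fin 3) :
    tripleJunction k = {x | 0 < cr (dir k) x ∧ 0 < cr x (dir (k + 1))} := by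
  rw [← dA_k, ← dA_k1]
  set α : ℝ := ((k : ℕ) : ℝ) * (2 * Real.pi / 3) with hα
  have hα1 : (((k : ℕ) : ℝ) + 1) * (2 * Real.pi / 3) = α + 2 * Real.pi / 3 := by rw [hα]; ring
  have hpi := Real.pi_pos
  ext x
  simp only [tripleJunction, mem_ofPred_eq, hα1, ← hα]
  constructor
  · rintro ⟨r, θ, hr, h1, h2, hx0, hx1⟩
    have e1 : cr (dA α) x = r * Real.sin (θ - α) := by
      simp [cr, dA, hx0, hx1, Real.sin_sub]; ring
    have e2 : cr x (dA (α + 2 * Real.pi / 3)) = r * Real.sin (α + 2 * Real.pi / 3 - θ) := by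
      simp only [cr, dA, hx0, hx1, Real.sin_sub]; simp; ring
    rw [e1, e2]
    exact ⟨mul_pos hr (Real.sin_pos_of_pos_of_lt_pi (by linarith) (by linarith)),
      mul_pos hr (Real.sin_pos_of_pos_of_lt_pi (by linarith) (by linarith))⟩
  · rintro ⟨h1, h2⟩
    set z : ℂ := ⟨x 0 * Real.cos α + x 1 * Real.sin α, cr (dA α) x⟩ with hz
    have hz1 : x 0 * Real.cos α + x 1 * Real.sin α = ‖z‖ * Real.cos z.arg :=
      (Complex.norm_mul_cos_arg z).symm
    have hz2 : cr (dA α) x = ‖z‖ * Real.sin z.arg := (Complex.norm_mul_sin_arg z).symm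
    have hz0 : z ≠ 0 := by
      intro h
      have : z.im = 0 := by rw [h]; rfl
      exact h1.ne' this
    have hr : 0 < ‖z‖ := norm_pos_iff.2 hz0
    have hcr : cr (dA α) x = Real.cos α * x 1 - Real.sin α * x 0 := by simp [cr, dA]
    have sc := Real.sin_sq_add_cos_sq α
    have hx0 : x 0 = ‖z‖ * Real.cos (α + z.arg) := by
      rw [Real.cos_add]
      linear_combination (Real.cos α) * hz1 - Real.sin α * hz2 + Real.sin α * hcr - x 0 * sc
    have hx1 : x 1 = ‖z‖ * Real.sin (α + z.arg) := by
      rw [Real.sin_add]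
      linear_combination (Real.sin α) * hz1 + Real.cos α * hz2 - Real.cos α * hcr - x 1 * sc
    have e2 : cr x (dA (α + 2 * Real.pi / 3)) = ‖z‖ * Real.sin (2 * Real.pi / 3 - z.arg) := by
      rw [show 2 * Real.pi / 3 - z.arg = (α + 2 * Real.pi / 3) - (α + z.arg) by ring, Real.sin_sub]
      simp only [cr, dA]
      rw [hx0, hx1]; simp; ring
    rw [hz2] at h1
    rw [e2] at h2
    have s1 : 0 < Real.sin z.arg := pos_of_mul_pos_right h1 hr.le
    have s2 : 0 < Real.sin (2 * Real.pi / 3 - z.arg) := pos_of_mul_pos_right h2 hr.le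
    have a1 : 0 < z.arg := by
      by_contra h
      exact absurd (Real.sin_nonpos_of_nonpos_of_neg_pi_le (not_lt.1 h)
        (Complex.neg_pi_lt_arg z).le) (not_le.2 s1)
    have a2 : z.arg < 2 * Real.pi / 3 := by
      by_contra h
      have := Complex.arg_le_pi z
      exact absurd (Real.sin_nonpos_of_nonpos_of_neg_pi_le (x := 2 * Real.pi / 3 - z.arg)
        (by linarith [not_lt.1 h]) (by linarith)) (not_le.2 s2)
    exact ⟨‖z‖, α + z.arg, hr, by linarith, by linarith, hx0, hx1⟩

theorem dir_unit (k : Fin 3) : dir k 0 ^ 2 + dir k 1 ^ 2 = 1 := by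
  have := sqrt3
  fin_cases k <;> simp [dir] <;> nlinarith

theorem dir_cr1 (k : Fin 3) : cr (dir k) (dir (k + 1)) = Real.sqrt 3 / 2 := by
  fin_cases k <;> simp [dir, cr] <;> ring

theorem dir_cr2 (k : Fin 3) : cr (dir (k + 1)) (dir (k + 2)) = Real.sqrt 3 / 2 := by
  fin_cases k <;> simp [dir, cr] <;> ring

theorem dir_cr3 (k : Fin 3) : cr (dir k) (dir (k + 2)) = -(Real.sqrt 3 / 2) := by
  fin_cases k <;> simp [dir, cr] <;> ring

theorem dir_sum (x : Rd 2) : cr (dir 0) x + cr (dir 1) x + cr (dir 2) x = 0 := by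
  simp [dir, cr]; ring

/-- calibration vectors -/
def wv (k : Fin 3) : Rd 2 := (Real.sqrt 3)⁻¹ • dir (k + 2)

theorem dir_dist (i j : Fin 3) : ‖dir i - dir j‖ ≤ Real.sqrt 3 := by
  have := sqrt3
  rw [EuclideanSpace.norm_eq, Fin.sum_univ_two]
  apply Real.sqrt_le_sqrt
  simp only [Real.norm_eq_abs, sq_abs, PiLp.sub_apply]
  fin_cases i <;> fin_cases j <;> simp [dir] <;> nlinarith

theorem wv_dist (i j : Fin 3) : ‖wv i - wv j‖ ≤ 1 := by
  have h3 : 0 < Real.sqrt 3 := by positivity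
  unfold wv
  rw [← smul_sub, norm_smul, norm_inv, Real.norm_of_nonneg h3.le, inv_mul_le_iff₀ h3, mul_one]
  exact dir_dist _ _

theorem cr_smul (a x : Rd 2) (c : ℝ) : cr a (c • x) = c * cr a x := by
  simp [cr]; ring

theorem fin3_adj : ∀ k j : Fin 3, k ≠ j → j = k + 1 ∨ k = j + 1 := by decide

theorem tj_isPartition : IsPartition Set.univ tripleJunction := by
  refine ⟨fun k => ?_, fun k j hkj => ?_, ?_⟩
  · rw [tj_eq]
    exact ((isOpen_lt continuous_const (cr_continuous _)).inter
      (isOpen_lt continuous_const (cr_continuous' _))).measurableSet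
  · have : tripleJunction k ∩ tripleJunction j = ∅ := by
      rw [tj_eq, tj_eq]
      ext x
      simp only [mem_inter_iff, mem_ofPred_eq, mem_empty_iff_false, iff_false]
      rintro ⟨⟨h1, h2⟩, h3, h4⟩
      have hk : j = k + 1 ∨ k = j + 1 := fin3_adj k j hkj
      rcases hk with rfl | rfl
      · rw [cr_swap] at h2; linarith
      · rw [cr_swap] at h4; linarith
    simp [this]
  · have hnull : ∀ k, volume {x : Rd 2 | cr (dir k) x = 0} = 0 := by
      intro k
      let L : Rd 2 →ₗ[ℝ] ℝ := 
        { toFun := cr (dir k)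
          map_add' := fun x y => by simp [cr]; ring
          map_smul' := fun c x => by simp [cr]; ring }
      have := Measure.addHaar_submodule (volume : Measure (Rd 2)) (LinearMap.ker L) (by
        intro h
        have h2 : dir (k + 1) ∈ LinearMap.ker L := by rw [h]; trivial
        have h3 : cr (dir k) (dir (k + 1)) = 0 := h2
        rw [dir_cr1] at h3
        have : 0 < Real.sqrt 3 / 2 := by positivity
        linarith)
      exact this
    refine measure_mono_null ?_ (measure_iUnion_null hnull)
    rintro x ⟨-, hx⟩
    simp only [mem_iUnion, not_exists, mem_ofPred_eq] at hx ⊢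
    by_contra! hne
    have hx' : ∀ k, ¬ (0 < cr (dir k) x ∧ 0 < cr x (dir (k + 1))) := fun k hk => by
      apply hx k; rw [tj_eq]; exact hk
    have hs := dir_sum x
    have x0 := hx' 0
    have x1 := hx' 1
    have x2 := hx' 2
    rw [cr_swap x] at x0 x1 x2
    simp only [zero_add, show (1 + 1 : Fin 3) = 2 from rfl, show (2 + 1 : Fin 3) = 0 from rfl] at x0 x1 x2
    have n0 := hne 0
    have n1 := hne 1
    have n2 := hne 2
    rcases lt_or_gt_of_ne n0 with m0 | m0 <;> rcases lt_or_gt_of_ne n1 with m1 | m1 <;>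
      rcases lt_or_gt_of_ne n2 with m2 | m2 <;>
      first
      | linarith
      | exact x0 ⟨m0, by linarith⟩
      | exact x1 ⟨m1, by linarith⟩
      | exact x2 ⟨m2, by linarith⟩

theorem dir_ne (k : Fin 3) : dir k ≠ 0 := by
  intro h
  have := dir_unit k
  rw [h] at this
  simp at this

theorem ray_int {E : Type*} [NormedAddCommGroup E] (k : Fin 3) {f : Rd 2 → E}
    (hf : Continuous f) (hc : HasCompactSupport f) :
    IntegrableOn (fun t : ℝ => f (t • dir k)) (Ioi 0) := by
  have h := hc.comp_isClosedEmbedding (line_emb (dir_ne k) 0)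
  have e : (f ∘ fun s : ℝ => s • dir k + 0) = fun t : ℝ => f (t • dir k) := by
    funext t; simp
  rw [e] at h
  exact (Continuous.integrable_of_hasCompactSupport (by fun_prop) h).integrableOn

theorem E_upper {η : Rd 2 → ℝ} (hη : ContDiff ℝ 1 η) (hc : HasCompactSupport η)
    {φ : Rd 2 → Rd 2} (hφ : ContDiff ℝ 1 φ) (hφc : HasCompactSupport φ)
    (hle : ∀ x, ‖φ x‖ ≤ η x) (k : Fin 3) :
    ∫ x in tripleJunction k, vdiv φ x ≤
      (∫ t in Ioi (0:ℝ), η (t • dir k)) + ∫ t in Ioi (0:ℝ), η (t • dir (k + 1)) := by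
  rw [tj_eq, gauss_green _ _ (by rw [dir_cr1]; positivity) hφ hφc]
  have hI : ∀ j, |∫ t in Ioi (0:ℝ), cr (dir j) (φ (t • dir j))| ≤
      ∫ t in Ioi (0:ℝ), η (t • dir j) := by
    intro j
    rw [← Real.norm_eq_abs]
    refine norm_integral_le_of_norm_le (ray_int j hη.continuous hc) (ae_of_all _ fun t => ?_)
    rw [Real.norm_eq_abs]
    exact (cr_le _ _ (dir_unit j)).trans (hle _)
  have h1 := abs_le.1 (hI k)
  have h2 := abs_le.1 (hI (k + 1))
  linarith [h1.1, h2.2]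

theorem E_calib {η : Rd 2 → ℝ} (hη : ContDiff ℝ 1 η) (hc : HasCompactSupport η) (k : Fin 3) :
    2 * ∫ x in tripleJunction k, fderiv ℝ η x (wv k) =
      (∫ t in Ioi (0:ℝ), η (t • dir k)) + ∫ t in Ioi (0:ℝ), η (t • dir (k + 1)) := by
  have h3 : 0 < Real.sqrt 3 := by positivity
  have g := gauss_green (dir k) (dir (k + 1)) (by rw [dir_cr1]; positivity)
    (φ := fun y => η y • wv k) (hη.smul contDiff_const) hc.smul_right
  rw [← tj_eq] at g
  simp_rw [vdiv_smul_const hη] at g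
  have a1 : cr (dir (k + 1)) (wv k) = 1 / 2 := by
    unfold wv; rw [cr_smul, dir_cr2]; field_simp
  have a2 : cr (dir k) (wv k) = - (1 / 2) := by
    unfold wv; rw [cr_smul, dir_cr3]; field_simp
  simp_rw [cr_smul, a1, a2] at g
  rw [integral_mul_const, integral_mul_const] at g
  rw [g]; ring

theorem main_cmp {B U : Set (Rd 2)} (hB : IsCompact B) (hU : IsOpen U) (hBU : B ⊆ U)
    {F : Fin 3 → Set (Rd 2)} (hF : IsPartition Set.univ F)
    (hEF : ∀ k, volume ((tripleJunction k ∆ F k) \ B) = 0)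
    (hfin : ∀ k, perimOpen (F k) U ≠ ∞) (φ : Fin 3 → Rd 2 → Rd 2)
    (hφ : ∀ k, ContDiff ℝ 1 (φ k)) (hφc : ∀ k, HasCompactSupport (φ k))
    (hφU : ∀ k, tsupport (φ k) ⊆ U) (hφ1 : ∀ k x, ‖φ k x‖ ≤ 1) :
    ∑ k, ∫ x in tripleJunction k, vdiv (φ k) x ≤ ∑ k, (perimOpen (F k) U).toReal := by
  refine le_of_forall_pos_le_add fun ε hε => ?_
  choose ψ hψ hψc hψU hψ1 hψP using fun k => perimOpen_approx (hfin k) (δ := ε / 3) (by positivity)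
  obtain ⟨η, hη, hηc, hηU, h0, h1, hK⟩ := cutoff
    (K := B ∪ ((⋃ k, tsupport (φ k)) ∪ ⋃ k, tsupport (ψ k)))
    (hB.union ((isCompact_iUnion fun k => hφc k).union (isCompact_iUnion fun k => hψc k))) hU
    (union_subset hBU (union_subset (iUnion_subset hφU) (iUnion_subset hψU)))
  have hφη : ∀ k x, ‖φ k x‖ ≤ η x := by
    intro k x
    by_cases hx : x ∈ tsupport (φ k)
    · rw [hK x (Or.inr (Or.inl (mem_iUnion.2 ⟨k, hx⟩)))]; exact hφ1 k x
    · rw [image_eq_zero_of_notMem_tsupport hx, norm_zero]; exact h0 x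
  have hψη : ∀ k x, ‖ψ k x‖ ≤ η x := by
    intro k x
    by_cases hx : x ∈ tsupport (ψ k)
    · rw [hK x (Or.inr (Or.inr (mem_iUnion.2 ⟨k, hx⟩)))]; exact hψ1 k x
    · rw [image_eq_zero_of_notMem_tsupport hx, norm_zero]; exact h0 x
  have hS := F_side wv wv_dist hF hU hfin hη hηc hηU h0 h1 ψ hψ hψc hψη
  have hz : ∀ x ∈ B, fderiv ℝ η x = 0 := by
    intro x hx
    apply IsLocalMax.fderiv_eq_zero
    exact Eventually.of_forall fun y => by rw [hK x (Or.inl hx)]; exact h1 y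
  have hsame : ∀ k, ∫ x in tripleJunction k, fderiv ℝ η x (wv k) =
      ∫ x in F k, fderiv ℝ η x (wv k) := by
    intro k
    rw [← integral_indicator (tj_isPartition.1 k), ← integral_indicator (hF.1 k)]
    apply integral_congr_ae
    have : ∀ᵐ x, x ∉ (tripleJunction k ∆ F k) \ B := measure_eq_zero_iff_ae_notMem.1 (hEF k)
    filter_upwards [this] with x hx
    by_cases hxB : x ∈ B
    · simp [indicator, hz x hxB]
    · have hx2 : x ∈ tripleJunction k ↔ x ∈ F k := by
        by_contra hcon
        apply hx
        refine ⟨?_, hxB⟩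
        rw [mem_symmDiff]
        tauto
      by_cases hx3 : x ∈ F k
      · rw [indicator_of_mem (hx2.2 hx3), indicator_of_mem hx3]
      · rw [indicator_of_notMem (fun h => hx3 (hx2.1 h)), indicator_of_notMem hx3]
  have hup : ∑ k, ∫ x in tripleJunction k, vdiv (φ k) x ≤
      2 * ∑ k, ∫ x in F k, fderiv ℝ η x (wv k) := by
    rw [Finset.mul_sum]
    refine Finset.sum_le_sum fun k _ => ?_
    rw [← hsame, E_calib hη hηc]
    exact E_upper hη hηc (hφ k) (hφc k) (hφη k) k
  have hlast : ∑ k, (2 * (perimOpen (F k) U).toReal - ∫ x in F k, vdiv (ψ k) x) ≤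
      ∑ k, ((perimOpen (F k) U).toReal + ε / 3) :=
    Finset.sum_le_sum fun k _ => by linarith [hψP k]
  rw [Finset.sum_add_distrib] at hlast
  simp only [Finset.sum_const, Finset.card_univ, Fintype.card_fin, nsmul_eq_mul] at hlast
  push_cast at hlast
  linarith

theorem open_cmp {B U : Set (Rd 2)} (hB : IsCompact B) (hU : IsOpen U) (hBU : B ⊆ U)
    {F : Fin 3 → Set (Rd 2)} (hF : IsPartition Set.univ F)
    (hEF : ∀ k, volume ((tripleJunction k ∆ F k) \ B) = 0) :
    ∑ k, perimOpen (tripleJunction k) U ≤ ∑ k, perimOpen (F k) U := by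
  by_cases hfin : ∀ k, perimOpen (F k) U ≠ ∞
  swap
  · push Not at hfin
    obtain ⟨k, hk⟩ := hfin
    have : ∑ k, perimOpen (F k) U = ∞ := ENNReal.sum_eq_top.2 ⟨k, Finset.mem_univ _, hk⟩
    rw [this]; exact le_top
  have hv0 : vdiv (0 : Rd 2 → Rd 2) = 0 := by funext x; simp [vdiv]
  have hEfin : ∀ k, perimOpen (tripleJunction k) U ≠ ∞ := by
    intro k
    refine ne_top_of_le_ne_top (b := ENNReal.ofReal (∑ k, (perimOpen (F k) U).toReal))
      ENNReal.ofReal_ne_top ?_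
    conv_lhs => unfold perimOpen
    refine iSup_le fun φ => iSup_le fun g1 => iSup_le fun g2 => iSup_le fun g3 =>
      iSup_le fun g4 => ENNReal.ofReal_le_ofReal ?_
    have := main_cmp hB hU hBU hF hEF hfin (fun j => if j = k then φ else 0)
      (fun j => by split_ifs; exacts [g1, contDiff_const])
      (fun j => by split_ifs; exacts [g2, HasCompactSupport.zero])
      (fun j => by split_ifs; exacts [g3, by simp [tsupport]])
      (fun j x => by split_ifs; exacts [g4 x, by simp])
    rw [Finset.sum_eq_single k] at this
    · simpa using this
    · intro j _ hj; simp [hj, hv0]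
    · simp
  have hR : ∑ k, (perimOpen (tripleJunction k) U).toReal ≤ ∑ k, (perimOpen (F k) U).toReal := by
    refine le_of_forall_pos_le_add fun ε hε => ?_
    choose φ g1 g2 g3 g4 g5 using fun k => perimOpen_approx (hEfin k) (δ := ε / 3) (by positivity)
    have := main_cmp hB hU hBU hF hEF hfin φ g1 g2 g3 g4
    have h5 := Finset.sum_le_sum fun k (_ : k ∈ Finset.univ) => g5 k
    rw [Finset.sum_sub_distrib] at h5
    simp only [Finset.sum_const, Finset.card_univ, Fintype.card_fin, nsmul_eq_mul] at h5
    push_cast at h5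
    linarith
  rw [← ENNReal.toReal_sum (fun k _ => hEfin k), ← ENNReal.toReal_sum (fun k _ => hfin k)] at hR
  exact (ENNReal.toReal_le_toReal (ENNReal.sum_ne_top.2 fun k _ => hEfin k)
    (ENNReal.sum_ne_top.2 fun k _ => hfin k)).1 hR

theorem perimOpen_mono {d : ℕ} (F : Set (Rd d)) {U V : Set (Rd d)} (h : U ⊆ V) :
    perimOpen F U ≤ perimOpen F V := by
  unfold perimOpen
  refine iSup_le fun φ => iSup_le fun g1 => iSup_le fun g2 => iSup_le fun g3 => iSup_le fun g4 => ?_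
  exact le_iSup₂_of_le φ g1 (le_iSup₂_of_le g2 (g3.trans h) (le_iSup_of_le g4 le_rfl))

theorem perim_cmp {B : Set (Rd 2)} (hB : IsCompact B)
    {F : Fin 3 → Set (Rd 2)} (hF : IsPartition Set.univ F)
    (hEF : ∀ k, volume ((tripleJunction k ∆ F k) \ B) = 0) :
    ∑ k, perim (tripleJunction k) B ≤ ∑ k, perim (F k) B := by
  by_cases hfin : ∀ k, perim (F k) B ≠ ∞
  swap
  · push Not at hfin
    obtain ⟨k, hk⟩ := hfin
    have : ∑ k, perim (F k) B = ∞ := ENNReal.sum_eq_top.2 ⟨k, Finset.mem_univ _, hk⟩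
    rw [this]; exact le_top
  refine ENNReal.le_of_forall_pos_le_add fun ε hε _ => ?_
  have hex : ∀ k, ∃ U, IsOpen U ∧ B ⊆ U ∧ perimOpen (F k) U ≤ perim (F k) B + (ε / 3 : NNReal) := by
    intro k
    have hlt : perim (F k) B < perim (F k) B + (ε / 3 : NNReal) :=
      ENNReal.lt_add_right (hfin k) (by
        have : 0 < ε / 3 := by positivity
        exact_mod_cast this.ne')
    conv_lhs at hlt => unfold perim
    simp only [iInf_lt_iff] at hlt
    obtain ⟨U, h1, h2, h3⟩ := hlt
    exact ⟨U, h1, h2, h3.le⟩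
  choose U hUo hBU hUP using hex
  have hVo : IsOpen (⋂ k, U k) := isOpen_iInter_of_finite hUo
  have hBV : B ⊆ ⋂ k, U k := subset_iInter hBU
  calc ∑ k, perim (tripleJunction k) B
      ≤ ∑ k, perimOpen (tripleJunction k) (⋂ k, U k) :=
        Finset.sum_le_sum fun k _ => iInf₂_le_of_le _ hVo (iInf_le_of_le hBV le_rfl)
    _ ≤ ∑ k, perimOpen (F k) (⋂ k, U k) := open_cmp hB hVo hBV hF hEF
    _ ≤ ∑ k, (perim (F k) B + (ε / 3 : NNReal)) :=
        Finset.sum_le_sum fun k _ => (perimOpen_mono _ (iInter_subset _ k)).trans (hUP k)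
    _ = ∑ k, perim (F k) B + ε := by
        rw [Finset.sum_add_distrib]
        congr 1
        rw [Finset.sum_const, Finset.card_univ, Fintype.card_fin, nsmul_eq_mul]
        have : (3 : NNReal) * (ε / 3) = ε := by field_simp
        exact_mod_cast this

/-- the triple junction is locally isoperimetric. The partition of the
plane into three open sectors of opening `2π/3` with common vertex at the origin is a
locally isoperimetric `3`-partition of `ℝ²`. -/
theorem tripleJunction_locallyIsoperimetric :
    LocallyIsoperimetric Set.univ tripleJunction := by
  refine ⟨tj_isPartition, fun B hB _ F hF hEF _ => ?_⟩
  exact ENNReal.div_le_div_right (perim_cmp hB hF hEF) 2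
end
end
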